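/- Let N ≥ 3, 0 < μ < μ₀ = (N-2)²/4, and for ρ ≥ 1 define V_ρ(x) = |x|^{-2}(1 + ρ|x|²)/(1 + |x|²) for x ∈ ℝ^N∖{0}. Then there exists ρ* ≥ μ₀/μ such that for every ρ with 1 ≤ ρ < ρ* the operator L_{μV_ρ} = -Δ - μV_ρ has a positive fundamental solution, and for every ρ > ρ* the operator L_{μV_ρ} admits no positive fundamental solution. -/

import Mathlib

open Filter MeasureTheory Metric

noncomputable section

/-- Euclidean space ℝ^N. -/
abbrev Euc (N : ℕ) : Type := EuclideanSpace ℝ (Fin N)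

/-- The Laplacian of `u` at `x`, as the sum of the pure second derivatives in the
coordinate directions. -/
def lap {N : ℕ} (u : Euc N → ℝ) (x : Euc N) : ℝ :=
  ∑ i : Fin N, fderiv ℝ (fun y => fderiv ℝ u y (EuclideanSpace.single i 1)) x
    (EuclideanSpace.single i 1)

/-- μ₀ = (N-2)²/4. -/
def mu0 (N : ℕ) : ℝ := ((N : ℝ) - 2) ^ 2 / 4

/-- τ₋(μ) = -(N-2)/2 - √(μ₀-μ). -/
def tauMinus (N : ℕ) (μ : ℝ) : ℝ := -((N : ℝ) - 2) / 2 - Real.sqrt (mu0 N - μ)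

/-- τ₊(μ) = -(N-2)/2 + √(μ₀-μ). -/
def tauPlus (N : ℕ) (μ : ℝ) : ℝ := -((N : ℝ) - 2) / 2 + Real.sqrt (mu0 N - μ)

/-- Surface area of the unit sphere in ℝ^N, i.e. N times the volume of the unit ball. -/
def sphereArea (N : ℕ) : ℝ := N * (volume (ball (0 : Euc N) 1)).toReal

/-- The normalizing constant c_μ: 2√(μ₀-μ)|𝕊^{N-1}| for μ < μ₀ and |𝕊^{N-1}| for μ = μ₀. -/
def cMu (N : ℕ) (μ : ℝ) : ℝ :=
  if μ < mu0 N then 2 * Real.sqrt (mu0 N - μ) * sphereArea N else sphereArea N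

/-- The normalizing constant c_N = ((N-2)|𝕊^{N-1}|)⁻¹ of the fundamental solution of -Δ. -/
def cN (N : ℕ) : ℝ := (((N : ℝ) - 2) * sphereArea N)⁻¹

/-- The singular profile Φ_μ: |x|^{τ₋(μ)} for μ < μ₀ and |x|^{-(N-2)/2}(-ln|x|) for μ = μ₀. -/
def PhiFun (N : ℕ) (μ : ℝ) (x : Euc N) : ℝ :=
  if μ < mu0 N then ‖x‖ ^ tauMinus N μ
  else ‖x‖ ^ (-((N : ℝ) - 2) / 2) * (-Real.log ‖x‖)

/-- The adjoint operator L*_μ ξ(x) = -Δξ(x) - 2τ₊(μ)|x|⁻² x·∇ξ(x). -/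
def LstarMu (N : ℕ) (μ : ℝ) (ξ : Euc N → ℝ) (x : Euc N) : ℝ :=
  -lap ξ x - 2 * tauPlus N μ / ‖x‖ ^ 2 * fderiv ℝ ξ x x

/-- The adjoint operator L*_{μV} ξ = L*_μ ξ - μ(V - |x|⁻²)ξ. -/
def LstarMuV (N : ℕ) (μ : ℝ) (V ξ : Euc N → ℝ) (x : Euc N) : ℝ :=
  LstarMu N μ ξ x - μ * (V x - ‖x‖ ^ (-2 : ℝ)) * ξ x

/-- A compactly supported C^{1,1} test function: compactly supported, differentiable,
with Lipschitz gradient. -/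
def IsC11c {N : ℕ} (ξ : Euc N → ℝ) : Prop :=
  HasCompactSupport ξ ∧ Differentiable ℝ ξ ∧ ∃ L : NNReal, LipschitzWith L (fderiv ℝ ξ)

/-- The dμ-distributional identity with constant `k`. -/
def DistribIdentity (N : ℕ) (μ : ℝ) (V u : Euc N → ℝ) (k : ℝ) : Prop :=
  ∀ ξ : Euc N → ℝ, IsC11c ξ →
    ∫ x : Euc N, u x * LstarMuV N μ V ξ x * ‖x‖ ^ tauPlus N μ = cMu N μ * k * ξ 0

/-- `u` is a classical solution of -Δu - μVu = 0 in ℝ^N∖{0}. -/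
def IsSolution (N : ℕ) (μ : ℝ) (V u : Euc N → ℝ) : Prop :=
  ContDiffOn ℝ 2 u {x : Euc N | x ≠ 0} ∧
  ∀ x : Euc N, x ≠ 0 → -lap u x - μ * V x * u x = 0

/-- `f` is locally γ-Hölder continuous on `s`. -/
def LocHolderOn {N : ℕ} (γ : ℝ) (s : Set (Euc N)) (f : Euc N → ℝ) : Prop :=
  ∀ x ∈ s, ∃ ε > 0, ∃ C > 0, ∀ y ∈ ball x ε ∩ s, ∀ z ∈ ball x ε ∩ s,
    |f y - f z| ≤ C * dist y z ^ γ

/-- The filter `‖x‖ → +∞` on ℝ^N. -/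
def normAtTop (N : ℕ) : Filter (Euc N) := comap norm atTop

/-- Assumption (V): V is locally Hölder and positive on ℝ^N∖{0},
0 ≤ V(x) - |x|⁻² ≤ c₀, and limsup_{|x|→∞} V(x)|x|² = α. -/
def AssumpV (N : ℕ) (V : Euc N → ℝ) (α : ℝ) : Prop :=
  (∃ γ : ℝ, 0 < γ ∧ γ < 1 ∧ LocHolderOn γ {x : Euc N | x ≠ 0} V) ∧
  (∀ x : Euc N, x ≠ 0 → 0 < V x) ∧
  (∃ c₀ : ℝ, 0 < c₀ ∧ ∀ x : Euc N, x ≠ 0 →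
    0 ≤ V x - ‖x‖ ^ (-2 : ℝ) ∧ V x - ‖x‖ ^ (-2 : ℝ) ≤ c₀) ∧
  limsup (fun x : Euc N => V x * ‖x‖ ^ 2) (normAtTop N) = α

/-- Assumption (Ṽ): V is locally Hölder and positive on ℝ^N∖{0},
0 ≤ V(x) - |x|⁻² ≤ c₀, and liminf_{|x|→∞} V(x)|x|² = β. -/
def AssumpVtilde (N : ℕ) (V : Euc N → ℝ) (β : ℝ) : Prop :=
  (∃ γ : ℝ, 0 < γ ∧ γ < 1 ∧ LocHolderOn γ {x : Euc N | x ≠ 0} V) ∧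
  (∀ x : Euc N, x ≠ 0 → 0 < V x) ∧
  (∃ c₀ : ℝ, 0 < c₀ ∧ ∀ x : Euc N, x ≠ 0 →
    0 ≤ V x - ‖x‖ ^ (-2 : ℝ) ∧ V x - ‖x‖ ^ (-2 : ℝ) ≤ c₀) ∧
  liminf (fun x : Euc N => V x * ‖x‖ ^ 2) (normAtTop N) = β

/-- The potential V_ρ(x) = |x|⁻²(1 + ρ|x|²)/(1 + |x|²). -/
def Vrho (N : ℕ) (ρ : ℝ) (x : Euc N) : ℝ :=
  ‖x‖ ^ (-2 : ℝ) * (1 + ρ * ‖x‖ ^ 2) / (1 + ‖x‖ ^ 2)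

/-- Ω has C² boundary: it is the sublevel set of a C² function whose differential
does not vanish on the boundary. -/
def HasC2Boundary {N : ℕ} (Ω : Set (Euc N)) : Prop :=
  ∃ φ : Euc N → ℝ, ContDiff ℝ 2 φ ∧ Ω = {x | φ x < 0} ∧
    ∀ x ∈ frontier Ω, fderiv ℝ φ x ≠ 0

open scoped Topology BoundedContinuousFunction

/-- Global solvability of the linear Cauchy problem with a bounded continuous coefficient. -/
theorem exists_global_linear_ode {E : Type*} [NormedAddCommGroup E] [NormedSpace ℝ E]
    [CompleteSpace E] (A : ℝ → E →L[ℝ] E) (hA : Continuous A) (K : ℝ) (hK : ∀ t, ‖A t‖ ≤ K)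
    (x₀ : E) : ∃ x : ℝ → E, x 0 = x₀ ∧ ∀ t, HasDerivAt x (A t (x t)) t := by
  have hK0 : 0 ≤ K := (norm_nonneg _).trans (hK 0)
  set κ : ℝ := 2 * K + 1 with hκ
  have hκ0 : 0 < κ := by positivity
  have hitg : ∀ v : ℝ →ᵇ E, Continuous fun s => A s (Real.cosh (κ * s) • v s) := fun v =>
    hA.clm_apply ((Real.continuous_cosh.comp (by fun_prop)).smul v.continuous)
  have hcosh : ∀ t, (∫ s in (0 : ℝ)..t, Real.cosh (κ * s)) = Real.sinh (κ * t) / κ := by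
    intro t
    rw [intervalIntegral.integral_comp_mul_left (fun s => Real.cosh s) hκ0.ne',
      intervalIntegral.integral_eq_sub_of_hasDerivAt (fun x _ => Real.hasDerivAt_sinh x)
        (Real.continuous_cosh.intervalIntegrable _ _)]
    simp [div_eq_inv_mul]
  have hsc : ∀ t, |Real.sinh t| ≤ Real.cosh t := fun t =>
    abs_le.2 ⟨by rw [Real.sinh_eq, Real.cosh_eq]; linarith [Real.exp_pos t],
      (Real.sinh_lt_cosh t).le⟩
  have hbd : ∀ (v : ℝ →ᵇ E) (t : ℝ),
      ‖∫ s in (0 : ℝ)..t, A s (Real.cosh (κ * s) • v s)‖ ≤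
        Real.cosh (κ * t) * (1 / 2 * ‖v‖) := by
    intro v t
    have h1 : ‖∫ s in (0 : ℝ)..t, A s (Real.cosh (κ * s) • v s)‖ ≤
        |∫ s in (0 : ℝ)..t, Real.cosh (κ * s) * (K * ‖v‖)| := by
      refine intervalIntegral.norm_integral_le_abs_of_norm_le (Eventually.of_forall fun s => ?_)
        (Continuous.intervalIntegrable (by fun_prop) _ _)
      calc _ ≤ ‖A s‖ * ‖Real.cosh (κ * s) • v s‖ := (A s).le_opNorm _
        _ ≤ K * (Real.cosh (κ * s) * ‖v‖) := by
          rw [norm_smul, Real.norm_of_nonneg (Real.cosh_pos _).le]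
          have := v.norm_coe_le_norm s
          have := (Real.cosh_pos (κ * s)).le
          gcongr
          exact hK s
        _ = _ := by ring
    refine h1.trans ?_
    rw [intervalIntegral.integral_mul_const, hcosh, abs_mul, abs_div, abs_of_pos hκ0,
      abs_of_nonneg (by positivity : 0 ≤ K * ‖v‖)]
    calc |Real.sinh (κ * t)| / κ * (K * ‖v‖) = |Real.sinh (κ * t)| * (K / κ * ‖v‖) := by ring
      _ ≤ Real.cosh (κ * t) * (1 / 2 * ‖v‖) := by
        have : K / κ ≤ 1 / 2 := by rw [div_le_div_iff₀ hκ0 two_pos]; linarith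
        have := hsc (κ * t)
        gcongr
  have hcinv : Continuous fun t => (Real.cosh (κ * t))⁻¹ :=
    Continuous.inv₀ (Real.continuous_cosh.comp (by fun_prop)) fun t => (Real.cosh_pos _).ne'
  have hprim : ∀ v : ℝ →ᵇ E, ∀ t, HasDerivAt
      (fun t => ∫ s in (0 : ℝ)..t, A s (Real.cosh (κ * s) • v s))
      (A t (Real.cosh (κ * t) • v t)) t := fun v t =>
    intervalIntegral.integral_hasDerivAt_right ((hitg v).intervalIntegrable _ _)
      ((hitg v).stronglyMeasurableAtFilter _ _) (hitg v).continuousAt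
  let T : (ℝ →ᵇ E) → (ℝ →ᵇ E) := fun v => BoundedContinuousFunction.ofNormedAddCommGroup
    (fun t => (Real.cosh (κ * t))⁻¹ • (x₀ + ∫ s in (0 : ℝ)..t, A s (Real.cosh (κ * s) • v s)))
    (hcinv.smul (continuous_const.add
      (continuous_iff_continuousAt.2 fun t => (hprim v t).continuousAt)))
    (‖x₀‖ + 1 / 2 * ‖v‖) (by
      intro t
      rw [norm_smul, norm_inv, Real.norm_of_nonneg (Real.cosh_pos _).le,
        inv_mul_le_iff₀ (Real.cosh_pos _)]
      refine (norm_add_le _ _).trans ?_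
      rw [mul_add]
      exact add_le_add (le_mul_of_one_le_left (norm_nonneg _) (Real.one_le_cosh _)) (hbd v t))
  have hT : ∀ v t, T v t =
      (Real.cosh (κ * t))⁻¹ • (x₀ + ∫ s in (0 : ℝ)..t, A s (Real.cosh (κ * s) • v s)) :=
    fun _ _ => rfl
  have hcontr : ContractingWith (1 / 2) T := by
    refine ⟨by rw [← NNReal.coe_lt_coe]; norm_num, LipschitzWith.of_dist_le_mul fun v w => ?_⟩
    rw [BoundedContinuousFunction.dist_le (by positivity)]
    intro t
    rw [dist_eq_norm, dist_eq_norm, hT, hT, ← smul_sub, add_sub_add_left_eq_sub,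
      ← intervalIntegral.integral_sub ((hitg v).intervalIntegrable _ _)
        ((hitg w).intervalIntegrable _ _), norm_smul, norm_inv,
      Real.norm_of_nonneg (Real.cosh_pos _).le, inv_mul_le_iff₀ (Real.cosh_pos _)]
    have := hbd (v - w) t
    simpa [smul_sub] using this
  obtain ⟨v, hv⟩ : ∃ v, T v = v := ⟨_, hcontr.fixedPoint_isFixedPt⟩
  have hv' : ∀ t, Real.cosh (κ * t) • v t =
      x₀ + ∫ s in (0 : ℝ)..t, A s (Real.cosh (κ * s) • v s) := fun t => by
    conv_lhs => rw [← hv, hT]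
    rw [smul_inv_smul₀ (Real.cosh_pos _).ne']
  refine ⟨fun t => Real.cosh (κ * t) • v t, by simpa using hv' 0, fun t => ?_⟩
  exact ((hprim v t).const_add x₀).congr_of_eventuallyEq (Eventually.of_forall hv')

/-- A solution with zero initial slope of the equation `w″ = Q w` with `Q ≥ 0` stays positive. -/
theorem pos_of_convex_ode {Q w y : ℝ → ℝ} (hQ : ∀ t, 0 ≤ Q t) (hw : ∀ t, HasDerivAt w (y t) t)
    (hy : ∀ t, HasDerivAt y (Q t * w t) t) (hw0 : w 0 = 1) (hy0 : y 0 = 0) :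
    (∀ t, 0 < w t) ∧ ∀ t ≤ 0, y t ≤ 0 := by
  have hmono : Monotone fun t => w t * y t :=
    monotone_of_hasDerivAt_nonneg (fun t => (hw t).mul (hy t)) fun t => by
      have := hQ t
      simp only [Pi.zero_apply]
      nlinarith [mul_self_nonneg (y t), mul_nonneg this (mul_self_nonneg (w t))]
  have hsq : ∀ t, HasDerivAt (fun t => w t * w t) (2 * (w t * y t)) t := fun t =>
    ((hw t).fun_mul (hw t)).congr_deriv (by ring)
  have hcont : Continuous fun t => w t * w t :=
    continuous_iff_continuousAt.2 fun t => (hsq t).continuousAt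
  have hsign₁ : ∀ t ≤ 0, w t * y t ≤ 0 := fun t ht => by simpa [hy0] using hmono ht
  have hsign₂ : ∀ t, 0 ≤ t → 0 ≤ w t * y t := fun t ht => by simpa [hy0] using hmono ht
  have hge : ∀ t, 1 ≤ w t * w t := by
    intro t
    rcases le_total t 0 with ht | ht
    · have : AntitoneOn (fun t => w t * w t) (Set.Iic 0) :=
        antitoneOn_of_hasDerivWithinAt_nonpos (convex_Iic 0) hcont.continuousOn
          (fun t _ => (hsq t).hasDerivWithinAt) fun t ht => by
            have := hsign₁ t (interior_subset (s := Set.Iic (0 : ℝ)) ht); linarith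
      simpa [hw0] using this (Set.mem_Iic.2 ht) Set.self_mem_Iic ht
    · have : MonotoneOn (fun t => w t * w t) (Set.Ici 0) :=
        monotoneOn_of_hasDerivWithinAt_nonneg (convex_Ici 0) hcont.continuousOn
          (fun t _ => (hsq t).hasDerivWithinAt) fun t ht => by
            have := hsign₂ t (interior_subset (s := Set.Ici (0 : ℝ)) ht); linarith
      simpa [hw0] using this Set.self_mem_Ici (Set.mem_Ici.2 ht) ht
  have hwc : Continuous w := continuous_iff_continuousAt.2 fun t => (hw t).continuousAt
  have hpos : ∀ t, 0 < w t := by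
    intro t
    by_contra! hle
    obtain ⟨s, hs⟩ : (0 : ℝ) ∈ Set.range w :=
      mem_range_of_exists_le_of_exists_ge hwc ⟨t, hle⟩ ⟨0, by rw [hw0]; exact zero_le_one⟩
    have := hge s
    rw [hs] at this
    norm_num at this
  exact ⟨hpos, fun t ht => nonpos_of_mul_nonpos_right (hsign₁ t ht) (hpos t)⟩

/-- The positive profile `m` behind the radial fundamental solution, in the variable
`t = log ‖x‖`; it has a finite nonzero limiting flux as `t → -∞`. -/
theorem exists_profile {a c : ℝ} (ha : 0 < a) (hc : 0 ≤ c) (hca : c ≤ a ^ 2) :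
    ∃ m n : ℝ → ℝ, (∀ t, HasDerivAt m (n t) t) ∧
      (∀ t, HasDerivAt n
        (2 * a * n t - c * Real.exp (2 * t) / (1 + Real.exp (2 * t)) * m t) t) ∧
      (∀ t, 0 < m t) ∧ (∃ C, ∀ t ≤ 0, m t ≤ C) ∧
      ∃ k, 0 < k ∧ Tendsto (fun t => 2 * a * m t - n t) atBot (𝓝 (2 * a * k)) := by
  set ψ : ℝ → ℝ := fun t => c * Real.exp (2 * t) / (1 + Real.exp (2 * t)) with hψ
  have hψ0 : ∀ t, 0 ≤ ψ t := fun t => by positivity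
  have hψc : ∀ t, ψ t ≤ c := fun t => by
    rw [hψ]; simp only
    rw [div_le_iff₀ (by positivity)]; nlinarith [Real.exp_pos (2 * t)]
  have hψe : ∀ t, ψ t ≤ c * Real.exp (2 * t) := fun t => by
    rw [hψ]; simp only
    exact div_le_self (by positivity) (by linarith [Real.exp_pos (2 * t)])
  have hψcont : Continuous ψ := by
    refine Continuous.div (by fun_prop) (by fun_prop) fun t => by positivity
  set Q : ℝ → ℝ := fun t => a ^ 2 - ψ t with hQ
  have hQ0 : ∀ t, 0 ≤ Q t := fun t => by have := hψc t; simp only [hQ]; linarith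
  have hQa : ∀ t, Q t ≤ a ^ 2 := fun t => by have := hψ0 t; simp only [hQ]; linarith
  let A : ℝ → (ℝ × ℝ) →L[ℝ] (ℝ × ℝ) := fun t =>
    (ContinuousLinearMap.inl ℝ ℝ ℝ).comp (ContinuousLinearMap.snd ℝ ℝ ℝ) +
      Q t • (ContinuousLinearMap.inr ℝ ℝ ℝ).comp (ContinuousLinearMap.fst ℝ ℝ ℝ)
  have hA : ∀ t x, A t x = (x.2, Q t * x.1) := fun t x => by simp [A]
  obtain ⟨x, hx0, hx⟩ := exists_global_linear_ode A (by fun_prop) (1 + a ^ 2)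
    (fun t => ContinuousLinearMap.opNorm_le_bound _ (by positivity) fun x => by
      rw [hA, Prod.norm_def]
      refine max_le ?_ ?_
      · have : ‖x.2‖ ≤ ‖x‖ := norm_snd_le x
        nlinarith [norm_nonneg x, sq_nonneg a]
      · have : ‖x.1‖ ≤ ‖x‖ := norm_fst_le x
        rw [norm_mul, Real.norm_of_nonneg (hQ0 t)]
        have := mul_le_mul (hQa t) this (norm_nonneg _) (sq_nonneg a)
        nlinarith [norm_nonneg x]) (1, 0)
  set w : ℝ → ℝ := fun t => (x t).1 with hwdef
  set y : ℝ → ℝ := fun t => (x t).2 with hydef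
  have hw : ∀ t, HasDerivAt w (y t) t := fun t =>
    ((ContinuousLinearMap.fst ℝ ℝ ℝ).hasFDerivAt.comp_hasDerivAt t (hx t)).congr_deriv (by
      simp [hA, hydef])
  have hy : ∀ t, HasDerivAt y (Q t * w t) t := fun t =>
    ((ContinuousLinearMap.snd ℝ ℝ ℝ).hasFDerivAt.comp_hasDerivAt t (hx t)).congr_deriv (by
      simp [hA, hwdef])
  have hw0 : w 0 = 1 := by simp [hwdef, hx0]
  have hy0 : y 0 = 0 := by simp [hydef, hx0]
  obtain ⟨hpos, hyneg⟩ := pos_of_convex_ode hQ0 hw hy hw0 hy0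
  have hexp : ∀ t, HasDerivAt (fun t => Real.exp (a * t)) (Real.exp (a * t) * a) t := fun t => by
    simpa using ((hasDerivAt_id t).const_mul a).exp
  have hm : ∀ t, HasDerivAt (fun t => w t * Real.exp (a * t))
      ((y t + a * w t) * Real.exp (a * t)) t := fun t =>
    ((hw t).fun_mul (hexp t)).congr_deriv (by ring)
  have hn : ∀ t, HasDerivAt (fun t => (y t + a * w t) * Real.exp (a * t))
      (2 * a * ((y t + a * w t) * Real.exp (a * t)) - ψ t * (w t * Real.exp (a * t))) t :=
    fun t => (((hy t).fun_add ((hw t).const_mul a)).fun_mul (hexp t)).congr_deriv (by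
      simp only [hQ]; ring)
  set P : ℝ → ℝ := fun t => (a * w t - y t) * Real.exp (a * t) with hP
  have hPd : ∀ t, HasDerivAt P (ψ t * (w t * Real.exp (a * t))) t := fun t =>
    ((((hw t).const_mul a).fun_sub (hy t)).fun_mul (hexp t)).congr_deriv (by
      simp only [hQ]; ring)
  have hPmono : Monotone P := monotone_of_hasDerivAt_nonneg hPd fun t =>
    mul_nonneg (hψ0 t) (mul_nonneg (hpos t).le (Real.exp_pos _).le)
  have hmP : ∀ t ≤ 0, a * (w t * Real.exp (a * t)) ≤ P t := fun t ht => by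
    have := hyneg t ht
    simp only [hP]
    nlinarith [Real.exp_pos (a * t)]
  have hP0 : P 0 = a := by simp [hP, hw0, hy0]
  set K : ℝ := c / (2 * a) with hK
  have hK0 : 0 ≤ K := by positivity
  set G : ℝ → ℝ := fun t => Real.exp (-K * Real.exp (2 * t)) with hG
  have hGd : ∀ t, HasDerivAt G (G t * (-K * (Real.exp (2 * t) * 2))) t := fun t => by
    have := ((((hasDerivAt_id t).const_mul 2).exp).const_mul (-K)).exp
    simpa [hG] using this
  have hanti : AntitoneOn (fun t => P t * G t) (Set.Iic 0) := by
    refine antitoneOn_of_hasDerivWithinAt_nonpos (convex_Iic 0)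
      (fun t _ => ((hPd t).mul (hGd t)).continuousAt.continuousWithinAt)
      (fun t _ => ((hPd t).mul (hGd t)).hasDerivWithinAt) fun t ht => ?_
    have h1 := hmP t (interior_subset (s := Set.Iic (0 : ℝ)) ht)
    have h2 : ψ t * (w t * Real.exp (a * t)) ≤ 2 * K * Real.exp (2 * t) * P t := by
      have h3 : w t * Real.exp (a * t) ≤ P t / a := by rw [le_div_iff₀ ha]; linarith
      have h4 : 0 ≤ w t * Real.exp (a * t) := mul_nonneg (hpos t).le (Real.exp_pos _).le
      calc _ ≤ (c * Real.exp (2 * t)) * (P t / a) :=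
            mul_le_mul (hψe t) h3 h4 (by positivity)
        _ = _ := by rw [hK]; field_simp
    have hGp : 0 < G t := Real.exp_pos _
    nlinarith
  have hPlow : ∀ t, a * Real.exp (-K) ≤ P t := by
    have hle1 : Real.exp (-K) ≤ 1 := Real.exp_le_one_iff.2 (by linarith)
    intro t
    rcases le_total t 0 with ht | ht
    · have h1 := hanti (Set.mem_Iic.2 ht) Set.self_mem_Iic ht
      have h2 : G t ≤ 1 := Real.exp_le_one_iff.2 (by nlinarith [Real.exp_pos (2 * t)])
      have h3 : 0 ≤ P t := (mul_nonneg ha.le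
        (mul_nonneg (hpos t).le (Real.exp_pos _).le)).trans (hmP t ht)
      have h4 : G 0 = Real.exp (-K) := by simp [hG]
      simp only [hP0, h4] at h1
      nlinarith
    · have := hPmono ht
      rw [hP0] at this
      nlinarith
  have hbdd : BddBelow (Set.range P) := ⟨a * Real.exp (-K), by rintro _ ⟨t, rfl⟩; exact hPlow t⟩
  have hlim := tendsto_atBot_ciInf hPmono hbdd
  have hinf : a * Real.exp (-K) ≤ ⨅ t, P t := le_ciInf hPlow
  refine ⟨_, _, hm, hn, fun t => mul_pos (hpos t) (Real.exp_pos _), ⟨1, fun t ht => ?_⟩,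
    (⨅ t, P t) / (2 * a), ?_, ?_⟩
  · have h1 := hmP t ht
    have h2 := hPmono ht
    rw [hP0] at h2
    nlinarith
  · have : 0 < a * Real.exp (-K) := by positivity
    exact div_pos (this.trans_le hinf) (by positivity)
  · convert hlim using 1
    · ext t; simp only [hP]; ring
    · congr 1; field_simp

theorem hasFDerivAt_log_norm {N : ℕ} {x : Euc N} (hx : x ≠ 0) :
    HasFDerivAt (fun y : Euc N => Real.log ‖y‖) ((‖x‖ ^ 2)⁻¹ • innerSL ℝ x) x := by
  have h := ((hasStrictFDerivAt_norm_sq x).hasFDerivAt.log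
    (pow_ne_zero 2 (norm_ne_zero_iff.2 hx))).const_mul (1 / 2)
  refine (h.congr_fderiv ?_).congr_of_eventuallyEq (Eventually.of_forall fun y => ?_)
  · ext v; simp; ring
  · simp [Real.log_pow]

theorem hasFDerivAt_comp_log_norm {N : ℕ} {F : ℝ → ℝ} {f : ℝ} {x : Euc N} (hx : x ≠ 0)
    (hF : HasDerivAt F f (Real.log ‖x‖)) :
    HasFDerivAt (fun y : Euc N => F (Real.log ‖y‖)) (f • (‖x‖ ^ 2)⁻¹ • innerSL ℝ x) x :=
  hF.comp_hasFDerivAt x (hasFDerivAt_log_norm hx)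

/-- The Laplacian of a radial function written in the variable `log ‖x‖`. -/
theorem lap_comp_log_norm {N : ℕ} {F F₁ F₂ : ℝ → ℝ} (hF : ∀ t, HasDerivAt F (F₁ t) t)
    (hF₁ : ∀ t, HasDerivAt F₁ (F₂ t) t) {x : Euc N} (hx : x ≠ 0) :
    lap (fun y : Euc N => F (Real.log ‖y‖)) x =
      (F₂ (Real.log ‖x‖) + ((N : ℝ) - 2) * F₁ (Real.log ‖x‖)) / ‖x‖ ^ 2 := by
  have hr : ‖x‖ ^ 2 ≠ 0 := pow_ne_zero 2 (norm_ne_zero_iff.2 hx)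
  have hterm : ∀ i : Fin N,
      fderiv ℝ (fun y => fderiv ℝ (fun y : Euc N => F (Real.log ‖y‖)) y
        (EuclideanSpace.single i 1)) x (EuclideanSpace.single i 1) =
      (F₂ (Real.log ‖x‖) - 2 * F₁ (Real.log ‖x‖)) / (‖x‖ ^ 2) ^ 2 * (x i) ^ 2 +
        F₁ (Real.log ‖x‖) / ‖x‖ ^ 2 := by
    intro i
    have hev : (fun y => fderiv ℝ (fun y : Euc N => F (Real.log ‖y‖)) y
        (EuclideanSpace.single i 1)) =ᶠ[𝓝 x]
        fun y => F₁ (Real.log ‖y‖) * ((‖y‖ ^ 2)⁻¹ * y i) := by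
      filter_upwards [isOpen_ne.mem_nhds hx] with y hy
      rw [(hasFDerivAt_comp_log_norm hy (hF _)).fderiv]
      simp [EuclideanSpace.inner_single_right]
    rw [hev.fderiv_eq]
    have h1 := hasFDerivAt_comp_log_norm hx (hF₁ _)
    have h2 : HasFDerivAt (fun y : Euc N => (‖y‖ ^ 2)⁻¹) _ x :=
      (hasDerivAt_inv hr).comp_hasFDerivAt x (hasStrictFDerivAt_norm_sq x).hasFDerivAt
    have h3 : HasFDerivAt (fun y : Euc N => y i) (EuclideanSpace.proj i : Euc N →L[ℝ] ℝ) x :=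
      (EuclideanSpace.proj i : Euc N →L[ℝ] ℝ).hasFDerivAt
    rw [(h1.fun_mul (h2.fun_mul h3)).fderiv]
    simp [EuclideanSpace.inner_single_right]
    field_simp
    ring
  have hsum : ∑ i : Fin N, (x i) ^ 2 = ‖x‖ ^ 2 := by
    rw [EuclideanSpace.norm_sq_eq]; simp
  rw [lap, Finset.sum_congr rfl fun i _ => hterm i, Finset.sum_add_distrib, ← Finset.mul_sum, hsum]
  simp
  field_simp
  ring

theorem contDiffOn_comp_log_norm {N : ℕ} {F : ℝ → ℝ} {n : WithTop ℕ∞} (hF : ContDiff ℝ n F) :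
    ContDiffOn ℝ n (fun y : Euc N => F (Real.log ‖y‖)) {x | x ≠ 0} := fun x hx =>
  (hF.contDiffAt.comp x ((contDiffAt_norm ℝ hx).log (norm_ne_zero_iff.2 hx))).contDiffWithinAt

theorem contDiff_two_of_hasDerivAt {F F₁ F₂ : ℝ → ℝ} (hF : ∀ t, HasDerivAt F (F₁ t) t)
    (hF₁ : ∀ t, HasDerivAt F₁ (F₂ t) t) (hc : Continuous F₂) : ContDiff ℝ 2 F := by
  have e : deriv F = F₁ := funext fun t => (hF t).deriv
  have e₁ : deriv F₁ = F₂ := funext fun t => (hF₁ t).deriv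
  rw [show (2 : WithTop ℕ∞) = 1 + 1 by norm_num, contDiff_succ_iff_deriv]
  refine ⟨fun t => (hF t).differentiableAt, by simp, ?_⟩
  rw [e, contDiff_one_iff_deriv, e₁]
  exact ⟨fun t => (hF₁ t).differentiableAt, hc⟩

theorem differentiableAt_fderiv_apply {N : ℕ} {z : Euc N → ℝ} {x : Euc N}
    (hz : ContDiffAt ℝ 2 z x) (v : Euc N) : DifferentiableAt ℝ (fun y => fderiv ℝ z y v) x :=
  ((hz.fderiv_right (m := 1) (by norm_num)).differentiableAt (by simp)).clm_apply
    (differentiableAt_const v)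

theorem eventually_differentiableAt_of_contDiffAt {N : ℕ} {z : Euc N → ℝ} {x : Euc N}
    (hz : ContDiffAt ℝ 2 z x) : ∀ᶠ y in 𝓝 x, DifferentiableAt ℝ z y :=
  (hz.eventually (by simp)).mono fun _ hy => hy.differentiableAt (by simp)

theorem lap_const_mul_sub {N : ℕ} {u φ : Euc N → ℝ} {x : Euc N} (hu : ContDiffAt ℝ 2 u x)
    (hφ : ContDiffAt ℝ 2 φ x) (M : ℝ) :
    lap (fun y => M * u y - φ y) x = M * lap u x - lap φ x := by
  rw [lap, lap, lap, Finset.mul_sum, ← Finset.sum_sub_distrib]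
  refine Finset.sum_congr rfl fun i _ => ?_
  have hev : (fun y => fderiv ℝ (fun y => M * u y - φ y) y (EuclideanSpace.single i 1)) =ᶠ[𝓝 x]
      fun y => M * fderiv ℝ u y (EuclideanSpace.single i 1) -
        fderiv ℝ φ y (EuclideanSpace.single i 1) := by
    filter_upwards [eventually_differentiableAt_of_contDiffAt hu,
      eventually_differentiableAt_of_contDiffAt hφ] with y h1 h2
    rw [((h1.hasFDerivAt.const_mul M).fun_sub h2.hasFDerivAt).fderiv]
    simp
  rw [hev.fderiv_eq, (((differentiableAt_fderiv_apply hu _).hasFDerivAt.const_mul M).fun_sub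
    (differentiableAt_fderiv_apply hφ _).hasFDerivAt).fderiv]
  simp

theorem deriv_deriv_nonneg_of_isLocalMin {f : ℝ → ℝ} {x : ℝ} (h : IsLocalMin f x)
    (hc : ContinuousAt f x) : 0 ≤ deriv (deriv f) x := by
  by_contra! hneg
  have hmax := isLocalMax_of_deriv_deriv_neg hneg h.deriv_eq_zero hc
  have hconst : f =ᶠ[𝓝 x] fun _ => f x := by
    filter_upwards [h, hmax] with y h1 h2 using le_antisymm h2 h1
  rw [hconst.deriv.deriv_eq] at hneg
  simp at hneg

theorem lap_nonneg_of_isLocalMin {N : ℕ} {z : Euc N → ℝ} {x : Euc N} (hz : ContDiffAt ℝ 2 z x)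
    (hmin : IsLocalMin z x) : 0 ≤ lap z x := by
  refine Finset.sum_nonneg fun i _ => ?_
  set v : Euc N := EuclideanSpace.single i 1
  have hl : ∀ s : ℝ, HasDerivAt (fun s : ℝ => x + s • v) v s := fun s => by
    simpa using ((hasDerivAt_id s).smul_const v).const_add x
  have h0 : x + (0 : ℝ) • v = x := by simp
  have htend : Tendsto (fun s : ℝ => x + s • v) (𝓝 0) (𝓝 x) := by
    simpa only [ContinuousAt, h0] using (hl 0).continuousAt
  have hd : deriv (fun s : ℝ => z (x + s • v)) =ᶠ[𝓝 0] fun s => fderiv ℝ z (x + s • v) v := by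
    filter_upwards [htend.eventually (eventually_differentiableAt_of_contDiffAt hz)] with s hs
    exact (hs.hasFDerivAt.comp_hasDerivAt s (hl s)).deriv
  have hdd : deriv (deriv fun s : ℝ => z (x + s • v)) 0 =
      fderiv ℝ (fun y => fderiv ℝ z y v) x v := by
    rw [hd.deriv_eq]
    have h2 := (differentiableAt_fderiv_apply hz v).hasFDerivAt
    rw [← h0] at h2
    have h3 := (h2.comp_hasDerivAt (0 : ℝ) (hl 0)).deriv
    rw [h0] at h3
    exact h3
  rw [← hdd]
  refine deriv_deriv_nonneg_of_isLocalMin ?_ ?_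
  · have := htend.eventually hmin
    filter_upwards [this] with s hs
    simpa [h0] using hs
  · have hzc : ContinuousAt z (x + (0 : ℝ) • v) := by rw [h0]; exact hz.continuousAt
    exact ContinuousAt.comp (f := fun s : ℝ => x + s • v) (x := 0) hzc (hl 0).continuousAt

theorem exp_two_mul_log {r : ℝ} (hr : 0 < r) : Real.exp (2 * Real.log r) = r ^ 2 := by
  rw [mul_comm, Real.exp_mul, Real.exp_log hr]; norm_cast

theorem Vrho_eq {N : ℕ} (ρ : ℝ) {x : Euc N} (hx : x ≠ 0) :
    Vrho N ρ x = (1 + ρ * Real.exp (2 * Real.log ‖x‖)) /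
      (1 + Real.exp (2 * Real.log ‖x‖)) / ‖x‖ ^ 2 := by
  have hr : 0 < ‖x‖ := norm_pos_iff.2 hx
  rw [Vrho, exp_two_mul_log hr, Real.rpow_neg hr.le, Real.rpow_ofNat]
  field_simp

theorem not_exists_pos_solution {N : ℕ} (hN : 3 ≤ N) {μ ρ : ℝ} (hμ : 0 < μ)
    (hρ : mu0 N / μ < ρ) {u : Euc N → ℝ} (hpos : ∀ x, x ≠ 0 → 0 < u x)
    (hu : IsSolution N μ (Vrho N ρ) u) : False := by
  rw [div_lt_iff₀ hμ] at hρ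
  obtain ⟨ω, hω0, hω⟩ : ∃ ω : ℝ, 0 < ω ∧ mu0 N + ω ^ 2 < ρ * μ :=
    ⟨√((ρ * μ - mu0 N) / 2), Real.sqrt_pos.2 (by linarith), by
      rw [Real.sq_sqrt (by linarith)]; linarith⟩
  set Λ : ℝ := mu0 N + ω ^ 2 with hΛ
  -- the potential beats `Λ / ‖x‖ ^ 2` near infinity
  obtain ⟨t₀, ht₀⟩ : ∃ t₀ : ℝ, ∀ t, t₀ ≤ t →
      Λ < μ * ((1 + ρ * Real.exp (2 * t)) / (1 + Real.exp (2 * t))) := by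
    have h1 : Tendsto (fun t : ℝ => Real.exp (2 * t) * (ρ * μ - Λ)) atTop atTop :=
      (Real.tendsto_exp_atTop.comp (tendsto_id.const_mul_atTop two_pos)).atTop_mul_const
        (by linarith)
    obtain ⟨t₀, ht₀⟩ := eventually_atTop.1 (h1.eventually_gt_atTop (Λ - μ))
    refine ⟨t₀, fun t ht => ?_⟩
    rw [← mul_div_assoc, lt_div_iff₀ (by positivity)]
    have := ht₀ t ht
    linarith
  set b : ℝ := ((N : ℝ) - 2) / 2 with hb
  set Φ : ℝ → ℝ := fun t => Real.exp (-b * t) * Real.sin (ω * (t - t₀)) with hΦ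
  set Φ₁ : ℝ → ℝ := fun t =>
    Real.exp (-b * t) * (ω * Real.cos (ω * (t - t₀)) - b * Real.sin (ω * (t - t₀))) with hΦ₁
  have he : ∀ t, HasDerivAt (fun t => Real.exp (-b * t)) (Real.exp (-b * t) * -b) t := fun t => by
    simpa using ((hasDerivAt_id t).const_mul (-b)).exp
  have hlin : ∀ t, HasDerivAt (fun t => ω * (t - t₀)) ω t := fun t => by
    simpa using ((hasDerivAt_id t).sub_const t₀).const_mul ω
  have hΦd : ∀ t, HasDerivAt Φ (Φ₁ t) t := fun t =>
    ((he t).fun_mul (hlin t).sin).congr_deriv (by simp only [hΦ₁]; ring)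
  have hΦ₁d : ∀ t, HasDerivAt Φ₁ (-((N : ℝ) - 2) * Φ₁ t - Λ * Φ t) t := fun t =>
    ((he t).fun_mul (((hlin t).cos.const_mul ω).fun_sub
      ((hlin t).sin.const_mul b))).congr_deriv (by
        simp only [hΦ₁, hΦ, hΛ, mu0, hb]; ring)
  have hΦc : ContDiff ℝ 2 Φ := by simp only [hΦ]; fun_prop
  set φ : Euc N → ℝ := fun x => Φ (Real.log ‖x‖) with hφ
  have hlapφ : ∀ x : Euc N, x ≠ 0 → lap φ x = -Λ * φ x / ‖x‖ ^ 2 := fun x hx => by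
    rw [hφ, lap_comp_log_norm hΦd hΦ₁d hx]; congr 1; ring
  have hφc := contDiffOn_comp_log_norm (N := N) hΦc
  set t₁ : ℝ := t₀ + Real.pi / ω with ht₁
  set K : Set (Euc N) := closedBall 0 (Real.exp t₁) ∩ {x | Real.exp t₀ ≤ ‖x‖} with hK
  have hKc : IsCompact K :=
    (isCompact_closedBall _ _).inter_right (isClosed_le continuous_const continuous_norm)
  have hK0 : ∀ x ∈ K, x ≠ 0 := fun x hx => norm_pos_iff.1 ((Real.exp_pos _).trans_le hx.2)
  have hKlog : ∀ x ∈ K, t₀ ≤ Real.log ‖x‖ ∧ Real.log ‖x‖ ≤ t₁ := fun x hx => by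
    have h0 := norm_pos_iff.2 (hK0 x hx)
    exact ⟨(Real.le_log_iff_exp_le h0).2 hx.2,
      (Real.log_le_iff_le_exp h0).2 (by simpa using hx.1)⟩
  have hopen : IsOpen {x : Euc N | x ≠ 0} := isOpen_ne
  have hquot : ContinuousOn (fun x => φ x / u x) K := by
    refine ContinuousOn.div (hφc.continuousOn.mono hK0) (hu.1.continuousOn.mono hK0)
      fun x hx => (hpos x (hK0 x hx)).ne'
  have hωt : ω * (t₁ - t₀) = Real.pi := by rw [ht₁]; field_simp; ring
  -- a point of the annulus where the comparison function is positive
  set tm : ℝ := t₀ + Real.pi / ω / 2 with htm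
  have hpi : 0 < Real.pi / ω := div_pos Real.pi_pos hω0
  set xm : Euc N := EuclideanSpace.single ⟨0, by omega⟩ (Real.exp tm) with hxm
  have hxmn : ‖xm‖ = Real.exp tm := by simp [hxm]
  have hxmK : xm ∈ K := by
    refine ⟨by simp only [mem_closedBall, dist_zero_right, hxmn, Real.exp_le_exp, htm, ht₁]
               linarith, ?_⟩
    simp only [Set.mem_ofPred_eq, hxmn, Real.exp_le_exp, htm]
    linarith
  have hφxm : 0 < φ xm := by
    simp only [hφ, hΦ, hxmn, Real.log_exp]
    have : ω * (tm - t₀) = Real.pi / 2 := by rw [htm]; field_simp; ring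
    rw [this, Real.sin_pi_div_two]
    positivity
  obtain ⟨x₀, hx₀K, hx₀max⟩ := hKc.exists_isMaxOn ⟨xm, hxmK⟩ hquot
  have hx₀ := hK0 x₀ hx₀K
  have hu₀ := hpos x₀ hx₀
  set M : ℝ := φ x₀ / u x₀ with hM
  have hM0 : 0 < M := (div_pos hφxm (hpos xm (hK0 xm hxmK))).trans_le (hx₀max hxmK)
  have hφ₀ : φ x₀ = M * u x₀ := by rw [hM]; field_simp
  have hφ₀pos : 0 < φ x₀ := by rw [hφ₀]; positivity
  obtain ⟨hl₀, hl₁⟩ := hKlog x₀ hx₀K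
  have hne₀ : t₀ ≠ Real.log ‖x₀‖ := fun h => by
    simp [hφ, hΦ, ← h] at hφ₀pos
  have hne₁ : Real.log ‖x₀‖ ≠ t₁ := fun h => by
    simp [hφ, hΦ, h, hωt] at hφ₀pos
  have hn₀ : 0 < ‖x₀‖ := norm_pos_iff.2 hx₀
  have hmin : IsLocalMin (fun x => M * u x - φ x) x₀ := by
    have hlt₀ : Real.exp t₀ < ‖x₀‖ := (Real.lt_log_iff_exp_lt hn₀).1 (lt_of_le_of_ne hl₀ hne₀)
    have hlt₁ : ‖x₀‖ < Real.exp t₁ := (Real.log_lt_iff_lt_exp hn₀).1 (lt_of_le_of_ne hl₁ hne₁)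
    have h1 := continuous_norm.continuousAt.eventually (lt_mem_nhds hlt₀)
    have h2 := continuous_norm.continuousAt.eventually (gt_mem_nhds hlt₁)
    filter_upwards [h1, h2] with x hx1 hx2
    have hxK : x ∈ K := ⟨by simpa using hx2.le, hx1.le⟩
    have h3 : φ x / u x ≤ M := hx₀max hxK
    rw [div_le_iff₀ (hpos x (hK0 x hxK))] at h3
    linarith
  have huc : ContDiffAt ℝ 2 u x₀ := hu.1.contDiffAt (hopen.mem_nhds hx₀)
  have hφca : ContDiffAt ℝ 2 φ x₀ := hφc.contDiffAt (hopen.mem_nhds hx₀)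
  have hlap := lap_nonneg_of_isLocalMin ((contDiffAt_const.mul huc).sub hφca) hmin
  rw [lap_const_mul_sub huc hφca, hlapφ x₀ hx₀] at hlap
  have heq := hu.2 x₀ hx₀
  rw [Vrho_eq ρ hx₀] at heq
  have hq := ht₀ _ hl₀
  set q := (1 + ρ * Real.exp (2 * Real.log ‖x₀‖)) / (1 + Real.exp (2 * Real.log ‖x₀‖))
  have hlapu : lap u x₀ = -(μ * q * u x₀ / ‖x₀‖ ^ 2) := by
    linear_combination -heq
  rw [hlapu] at hlap
  have : M * -(μ * q * u x₀ / ‖x₀‖ ^ 2) - -Λ * φ x₀ / ‖x₀‖ ^ 2 =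
      (Λ - μ * q) * φ x₀ / ‖x₀‖ ^ 2 := by rw [hφ₀]; ring
  rw [this] at hlap
  have : (Λ - μ * q) * φ x₀ / ‖x₀‖ ^ 2 < 0 :=
    div_neg_of_neg_of_pos (mul_neg_of_neg_of_pos (by linarith) hφ₀pos) (by positivity)
  linarith

namespace IsC11c

variable {N : ℕ} {ξ : Euc N → ℝ}

theorem continuous_fderiv (h : IsC11c ξ) : Continuous (fderiv ℝ ξ) := by
  obtain ⟨-, -, L, hL⟩ := h
  exact hL.continuous

theorem exists_lipschitz_partial (h : IsC11c ξ) : ∃ L : NNReal, ∀ i : Fin N,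
    LipschitzWith L fun x => fderiv ℝ ξ x (EuclideanSpace.single i 1) := by
  obtain ⟨-, -, L, hL⟩ := h
  refine ⟨L, fun i => LipschitzWith.of_dist_le_mul fun x y => ?_⟩
  rw [Real.dist_eq, ← sub_apply, ← Real.norm_eq_abs]
  refine (ContinuousLinearMap.le_opNorm _ _).trans ?_
  rw [PiLp.norm_single, norm_one, mul_one, ← dist_eq_norm]
  exact hL.dist_le_mul x y

theorem measurable_lap : Measurable (lap ξ) :=
  Finset.measurable_fun_sum _ fun _ _ => measurable_fderiv_apply_const _ _ _

theorem exists_norm_partial_partial_le (h : IsC11c ξ) : ∃ L : ℝ, 0 ≤ L ∧ ∀ (i : Fin N) (x : Euc N),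
    ‖fderiv ℝ (fun y => fderiv ℝ ξ y (EuclideanSpace.single i 1)) x
      (EuclideanSpace.single i 1)‖ ≤ L := by
  obtain ⟨L, hL⟩ := h.exists_lipschitz_partial
  refine ⟨L, L.2, fun i x => (ContinuousLinearMap.le_opNorm _ _).trans ?_⟩
  rw [PiLp.norm_single, norm_one, mul_one]
  exact norm_fderiv_le_of_lipschitz ℝ (hL i)

theorem exists_norm_lap_le (h : IsC11c ξ) : ∃ L : ℝ, 0 ≤ L ∧ ∀ x, ‖lap ξ x‖ ≤ L := by
  obtain ⟨L, hL0, hL⟩ := h.exists_norm_partial_partial_le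
  refine ⟨∑ _i : Fin N, L, Finset.sum_nonneg fun _ _ => hL0, fun x => ?_⟩
  exact norm_sum_le_of_le _ fun i _ => hL i x

theorem integrable_bdd_mul_partial_partial (h : IsC11c ξ) {f : Euc N → ℝ} (hf : Continuous f)
    (i : Fin N) : Integrable fun x => f x *
      fderiv ℝ (fun y => fderiv ℝ ξ y (EuclideanSpace.single i 1)) x
        (EuclideanSpace.single i 1) := by
  obtain ⟨L, hL0, hL⟩ := h.exists_norm_partial_partial_le
  have hs : HasCompactSupport fun x =>
      fderiv ℝ (fun y => fderiv ℝ ξ y (EuclideanSpace.single i 1)) x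
        (EuclideanSpace.single i 1) := (h.1.fderiv_apply ℝ _).fderiv_apply ℝ _
  set D : Euc N → ℝ := fun x => fderiv ℝ (fun y => fderiv ℝ ξ y (EuclideanSpace.single i 1)) x
        (EuclideanSpace.single i 1) with hD
  have hitg : IntegrableOn (fun x => f x * L) (tsupport D) :=
    (hf.mul continuous_const).continuousOn.integrableOn_compact hs
  have h0 : ∀ x ∉ tsupport D, f x * D x = 0 := fun x hx => by
    rw [image_eq_zero_of_notMem_tsupport hx, mul_zero]
  rw [← integrableOn_iff_integrable_of_support_subset (s := tsupport D)
    (fun x hx => by by_contra hn; exact hx (h0 x hn))]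
  refine Integrable.mono hitg (hf.measurable.mul (measurable_fderiv_apply_const _ _ _)).aestronglyMeasurable
    (Eventually.of_forall fun x => ?_)
  rw [norm_mul, norm_mul, Real.norm_of_nonneg hL0]
  exact mul_le_mul_of_nonneg_left (hL i x) (norm_nonneg _)

theorem integrable_mul_lap (h : IsC11c ξ) {f : Euc N → ℝ} (hf : Continuous f) :
    Integrable fun x => f x * lap ξ x := by
  simp only [lap, Finset.mul_sum]
  exact integrable_finsetSum _ fun i _ => h.integrable_bdd_mul_partial_partial hf i

theorem exists_support_subset (h : IsC11c ξ) : ∃ R : ℝ, 0 < R ∧ ∀ x, R ≤ ‖x‖ →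
    ξ x = 0 ∧ fderiv ℝ ξ x = 0 ∧ lap ξ x = 0 := by
  obtain ⟨R, hR⟩ := h.1.isCompact.isBounded.subset_closedBall (0 : Euc N)
  refine ⟨max R 0 + 1, by positivity, fun x hx => ?_⟩
  have hout : x ∉ tsupport ξ := fun hx' => by
    have := hR hx'
    rw [mem_closedBall, dist_zero_right] at this
    linarith [le_max_left R 0]
  have hev : ξ =ᶠ[𝓝 x] fun _ => 0 := notMem_tsupport_iff_eventuallyEq.1 hout
  refine ⟨hev.eq_of_nhds, by rw [hev.fderiv_eq]; simp, Finset.sum_eq_zero fun i _ => ?_⟩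
  have hev' : (fun y => fderiv ℝ ξ y (EuclideanSpace.single i 1)) =ᶠ[𝓝 x] fun _ => 0 :=
    (hev.fderiv (𝕜 := ℝ)).mono fun y hy => by simp [hy]
  rw [hev'.fderiv_eq]; simp

/-- Integration by parts against a Lipschitz function. -/
theorem integral_mul_lap (h : IsC11c ξ) {f : Euc N → ℝ} {C : NNReal} (hf : LipschitzWith C f) :
    ∫ x, f x * lap ξ x = -∑ i : Fin N, ∫ x,
      lineDeriv ℝ f x (EuclideanSpace.single i 1) * fderiv ℝ ξ x (EuclideanSpace.single i 1) := by
  obtain ⟨L, hL⟩ := h.exists_lipschitz_partial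
  simp only [lap, Finset.mul_sum]
  rw [integral_finsetSum _ fun i _ => h.integrable_bdd_mul_partial_partial hf.continuous i,
    ← Finset.sum_neg_distrib]
  refine Finset.sum_congr rfl fun i _ => ?_
  rw [hf.integral_lineDeriv_mul_eq (hL i) (h.1.fderiv_apply ℝ _), ← integral_neg]
  refine integral_congr_ae ?_
  filter_upwards [(hL i).ae_differentiableAt] with x hx
  rw [hx.lineDeriv_eq_fderiv, map_neg]
  ring

end IsC11c

theorem sum_mul_apply_single {N : ℕ} (T : Euc N →L[ℝ] ℝ) (x : Euc N) :
    ∑ i : Fin N, x i * T (EuclideanSpace.single i 1) = T x := by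
  conv_rhs => rw [← (EuclideanSpace.basisFun (Fin N) ℝ).sum_repr x]
  simp

theorem exists_lipschitz_clamp {G G₁ : ℝ → ℝ} (hG : ∀ r, 0 < r → HasDerivAt G (G₁ r) r)
    (hG₁ : ContinuousOn G₁ (Set.Ioi 0)) {ε R : ℝ} (hε : 0 < ε) :
    ∃ C, LipschitzWith C fun r => G (max ε (min R r)) := by
  obtain ⟨C, hC⟩ := (isCompact_Icc (a := ε) (b := max ε R)).exists_bound_of_continuousOn
    (hG₁.mono fun r hr => hε.trans_le hr.1)
  have hlip : LipschitzOnWith C.toNNReal G (Set.Icc ε (max ε R)) :=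
    (convex_Icc _ _).lipschitzOnWith_of_nnnorm_hasDerivWithin_le
      (fun r hr => (hG r (hε.trans_le hr.1)).hasDerivWithinAt) fun r hr => by
        rw [← NNReal.coe_le_coe, coe_nnnorm]
        exact (hC r hr).trans (Real.le_coe_toNNReal _)
  have hcl : LipschitzWith 1 fun r : ℝ => max ε (min R r) :=
    (LipschitzWith.id.const_min R).const_max ε
  refine ⟨C.toNNReal * 1, lipschitzOnWith_univ.1 (hlip.comp hcl.lipschitzOnWith fun r _ =>
    ⟨le_max_left _ _, max_le_max le_rfl (min_le_left _ _)⟩)⟩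

/-- Weak form of the Laplacian against a radial function truncated near the origin. -/
theorem integral_truncated_radial_mul_lap {N : ℕ} (hN : N ≠ 0) {ξ : Euc N → ℝ} (h : IsC11c ξ)
    {G G₁ : ℝ → ℝ} (hG : ∀ r, 0 < r → HasDerivAt G (G₁ r) r)
    (hG₁ : ContinuousOn G₁ (Set.Ioi 0)) {ε : ℝ} (hε : 0 < ε) :
    ∫ x, G (max ε ‖x‖) * lap ξ x =
      -∫ x in {x : Euc N | ε < ‖x‖}, G₁ ‖x‖ / ‖x‖ * fderiv ℝ ξ x x := by
  have : Nonempty (Fin N) := Fin.pos_iff_nonempty.1 (Nat.pos_of_ne_zero hN)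
  obtain ⟨R, hR0, hR⟩ := h.exists_support_subset
  obtain ⟨C, hC⟩ := exists_lipschitz_clamp hG hG₁ (R := R) hε
  set f : Euc N → ℝ := fun x => G (max ε (min R ‖x‖)) with hf
  have hflip : LipschitzWith (C * 1) f := hC.comp lipschitzWith_one_norm
  have hmeas : MeasurableSet {x : Euc N | ε < ‖x‖} := measurableSet_lt measurable_const
    measurable_norm
  have h1 : ∫ x, G (max ε ‖x‖) * lap ξ x = ∫ x, f x * lap ξ x := by
    congr 1; ext x
    rcases le_total R ‖x‖ with hx | hx
    · rw [(hR x hx).2.2, mul_zero, mul_zero]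
    · simp only [hf, min_eq_right hx]
  set k : ℝ → ℝ := fun r => G₁ (max ε r) / max ε r with hk
  have hkc : Continuous k := by
    have hmax : Continuous fun r : ℝ => max ε r := by fun_prop
    refine Continuous.div ?_ hmax fun r => (hε.trans_le (le_max_left _ _)).ne'
    exact hG₁.comp_continuous hmax fun r => hε.trans_le (le_max_left _ _)
  have hderiv : ∀ i : Fin N, (fun x => lineDeriv ℝ f x (EuclideanSpace.single i 1) *
      fderiv ℝ ξ x (EuclideanSpace.single i 1)) =ᵐ[volume]
      {x : Euc N | ε < ‖x‖}.indicator fun x =>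
        k ‖x‖ * (x i * fderiv ℝ ξ x (EuclideanSpace.single i 1)) := by
    intro i
    have hsph : ∀ᵐ x : Euc N, x ∉ sphere (0 : Euc N) ε :=
      measure_eq_zero_iff_ae_notMem.1 (Measure.addHaar_sphere volume _ _)
    filter_upwards [hsph] with x hx
    have hx' : ‖x‖ ≠ ε := by simpa using hx
    rcases le_or_gt R ‖x‖ with hxR | hxR
    · simp [(hR x hxR).2.1, Set.indicator_apply]
    rcases lt_or_gt_of_ne hx' with hlt | hgt
    · rw [Set.indicator_of_notMem (by simpa using hlt.le)]
      have hev : f =ᶠ[𝓝 x] fun _ => G ε := by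
        filter_upwards [continuous_norm.continuousAt.eventually (gt_mem_nhds hlt)] with y hy
        simp only [hf, max_eq_left ((min_le_right R _).trans hy.le)]
      rw [hev.lineDeriv_eq]; simp [lineDeriv]
    · rw [Set.indicator_of_mem (s := {x : Euc N | ε < ‖x‖}) hgt]
      have hx0 : x ≠ 0 := norm_pos_iff.1 (hε.trans hgt)
      have hev : f =ᶠ[𝓝 x] fun y => (fun t => G (Real.exp t)) (Real.log ‖y‖) := by
        filter_upwards [continuous_norm.continuousAt.eventually (lt_mem_nhds hgt),
          continuous_norm.continuousAt.eventually (gt_mem_nhds hxR)] with y hy hy'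
        simp only [hf, min_eq_right hy'.le, max_eq_right hy.le]
        rw [Real.exp_log (hε.trans hy)]
      have hd := hasFDerivAt_comp_log_norm hx0 (F := fun t => G (Real.exp t))
        (HasDerivAt.comp _ (hG _ (Real.exp_pos _)) (Real.hasDerivAt_exp _))
      rw [hev.lineDeriv_eq, hd.differentiableAt.lineDeriv_eq_fderiv, hd.fderiv]
      simp only [hk, max_eq_right hgt.le, Real.exp_log (hε.trans hgt)]
      have := (hε.trans hgt).ne'
      simp [EuclideanSpace.inner_single_right]
      field_simp
  have hitg : ∀ i : Fin N, Integrable ({x : Euc N | ε < ‖x‖}.indicator fun x =>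
        k ‖x‖ * (x i * fderiv ℝ ξ x (EuclideanSpace.single i 1))) := by
    intro i
    refine Integrable.indicator ?_ hmeas
    refine Continuous.integrable_of_hasCompactSupport ?_
      ((h.1.fderiv_apply ℝ _).mul_left.mul_left)
    have := h.continuous_fderiv
    fun_prop
  rw [h1, h.integral_mul_lap hflip, Finset.sum_congr rfl fun i _ => integral_congr_ae (hderiv i),
    ← integral_finsetSum _ fun i _ => hitg i, ← integral_indicator hmeas]
  congr 2; ext x
  by_cases hx : ε < ‖x‖
  · have hx' : x ∈ {x : Euc N | ε < ‖x‖} := hx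
    simp only [Set.indicator_of_mem hx', ← Finset.mul_sum, sum_mul_apply_single, hk,
      max_eq_right hx.le]
  · have hx' : x ∉ {x : Euc N | ε < ‖x‖} := hx
    simp only [Set.indicator_of_notMem hx', Finset.sum_const_zero]

/-- Integration in polar coordinates. -/
theorem integral_eq_integral_sphere_integral_Ioi {E : Type*} [NormedAddCommGroup E]
    [NormedSpace ℝ E] [MeasurableSpace E] [BorelSpace E] [FiniteDimensional ℝ E] [Nontrivial E]
    (ν : Measure E) [ν.IsAddHaarMeasure] {f : E → ℝ} (hf : Integrable f ν) :
    ∫ x, f x ∂ν = ∫ ω : sphere (0 : E) 1,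
      (∫ r in Set.Ioi (0 : ℝ), r ^ (Module.finrank ℝ E - 1) * f (r • (ω : E))) ∂ν.toSphere := by
  set n := Module.finrank ℝ E - 1 with hn
  have hmp := ν.measurePreserving_homeomorphUnitSphereProd
  have hemb := (homeomorphUnitSphereProd E).measurableEmbedding
  set g : sphere (0 : E) 1 × Set.Ioi (0 : ℝ) → ℝ := fun y => f ((y.2 : ℝ) • (y.1 : E)) with hg
  have hcomp : g ∘ homeomorphUnitSphereProd E = fun x : ({0}ᶜ : Set E) => f x := by
    ext x
    have := congrArg (Subtype.val) ((homeomorphUnitSphereProd E).symm_apply_apply x)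
    rw [homeomorphUnitSphereProd_symm_apply_coe] at this
    simp only [Function.comp_apply, hg, this]
  have hgi : Integrable g (ν.toSphere.prod (.volumeIoiPow n)) := by
    rw [← hmp.integrable_comp_emb hemb, hcomp]
    have h := hf
    rw [← restrict_compl_singleton (μ := ν) 0, ← IntegrableOn,
      integrableOn_iff_comap_subtypeVal (measurableSet_singleton _).compl] at h
    exact h
  calc ∫ x, f x ∂ν = ∫ x : ({0}ᶜ : Set E), f x ∂(ν.comap (↑)) := by
        rw [integral_subtype_comap (measurableSet_singleton _).compl f, restrict_compl_singleton]
    _ = ∫ y, g y ∂ν.toSphere.prod (.volumeIoiPow n) := by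
        rw [← hmp.integral_comp hemb]; exact congrArg (fun h => ∫ x, h x ∂_) hcomp.symm
    _ = ∫ ω, ∫ r, g (ω, r) ∂(.volumeIoiPow n) ∂ν.toSphere := integral_prod _ hgi
    _ = _ := by
        congr 1; ext ω
        simp only [Measure.volumeIoiPow, ENNReal.ofReal, hg]
        rw [integral_withDensity_eq_integral_smul,
          integral_subtype_comap measurableSet_Ioi
            fun r : ℝ => Real.toNNReal (r ^ n) • f (r • (ω : E)),
          setIntegral_congr_fun measurableSet_Ioi fun x hx => ?_]
        · rw [NNReal.smul_def, Real.coe_toNNReal _ (pow_nonneg hx.out.le _), smul_eq_mul]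
        · exact (measurable_subtype_coe.pow_const _).real_toNNReal

/-- The divergence theorem on the exterior of a ball for the field
`p(‖x‖) ξ(x) x / ‖x‖ ^ N`. -/
theorem integral_exterior_radial_flux {N : ℕ} (hN : N ≠ 0) {ξ : Euc N → ℝ} (h : IsC11c ξ)
    {p p₁ : ℝ → ℝ} (hp : ∀ r, 0 < r → HasDerivAt p (p₁ r) r)
    (hp₁ : ContinuousOn p₁ (Set.Ioi 0)) {ε : ℝ} (hε : 0 < ε) :
    IntegrableOn (fun x => (p ‖x‖ * fderiv ℝ ξ x x / ‖x‖ + p₁ ‖x‖ * ξ x) / ‖x‖ ^ (N - 1))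
      {x : Euc N | ε < ‖x‖} ∧
    ∫ x in {x : Euc N | ε < ‖x‖},
      (p ‖x‖ * fderiv ℝ ξ x x / ‖x‖ + p₁ ‖x‖ * ξ x) / ‖x‖ ^ (N - 1) =
      -p ε * ∫ ω : sphere (0 : Euc N) 1, ξ (ε • (ω : Euc N)) ∂(volume : Measure (Euc N)).toSphere := by
  have : Nonempty (Fin N) := Fin.pos_iff_nonempty.1 (Nat.pos_of_ne_zero hN)
  obtain ⟨R, hR0, hR⟩ := h.exists_support_subset
  have hmeas : MeasurableSet {x : Euc N | ε < ‖x‖} := measurableSet_lt measurable_const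
    measurable_norm
  have hpc : ContinuousOn p (Set.Ioi 0) := fun r hr => (hp r hr).continuousAt.continuousWithinAt
  have hfc := h.continuous_fderiv
  have hξc : Continuous ξ := h.2.1.continuous
  set H : Euc N → ℝ := fun x =>
    (p ‖x‖ * fderiv ℝ ξ x x / ‖x‖ + p₁ ‖x‖ * ξ x) / ‖x‖ ^ (N - 1) with hH
  set H' : Euc N → ℝ := fun x => (p (max ε ‖x‖) * fderiv ℝ ξ x x / max ε ‖x‖ +
    p₁ (max ε ‖x‖) * ξ x) / max ε ‖x‖ ^ (N - 1) with hH'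
  have hmax : Continuous fun x : Euc N => max ε ‖x‖ := by fun_prop
  have hmaxpos : ∀ x : Euc N, 0 < max ε ‖x‖ := fun x => hε.trans_le (le_max_left _ _)
  have hH'c : Continuous H' := by
    have h1 := hpc.comp_continuous hmax hmaxpos
    have h2 := hp₁.comp_continuous hmax hmaxpos
    have h3 : Continuous fun x => fderiv ℝ ξ x x := by fun_prop
    exact (((h1.mul h3).div hmax fun x => (hmaxpos x).ne').add (h2.mul hξc)).div (hmax.pow _)
      fun x => pow_ne_zero _ (hmaxpos x).ne'
  have hH's : HasCompactSupport H' := by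
    refine HasCompactSupport.intro (isCompact_closedBall (0 : Euc N) R) fun x hx => ?_
    have hx' : R ≤ ‖x‖ := by
      rw [mem_closedBall, dist_zero_right, not_le] at hx; exact hx.le
    simp [hH', (hR x hx').1, (hR x hx').2.1]
  have hind : {x : Euc N | ε < ‖x‖}.indicator H = {x : Euc N | ε < ‖x‖}.indicator H' := by
    refine Set.indicator_congr fun x hx => ?_
    have hx' : ε < ‖x‖ := hx
    simp only [hH, hH', max_eq_right hx'.le]
  have hitg : Integrable ({x : Euc N | ε < ‖x‖}.indicator H) := by
    rw [hind]; exact (hH'c.integrable_of_hasCompactSupport hH's).indicator hmeas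
  refine ⟨(integrable_indicator_iff hmeas).1 hitg, ?_⟩
  rw [← integral_indicator hmeas, integral_eq_integral_sphere_integral_Ioi volume hitg,
    ← integral_const_mul]
  congr 1; ext ω
  have hω : ‖(ω : Euc N)‖ = 1 := by simp
  have hnorm : ∀ r : ℝ, 0 < r → ‖r • (ω : Euc N)‖ = r := fun r hr => by
    rw [norm_smul, hω, mul_one, Real.norm_of_nonneg hr.le]
  have hline : ∀ r : ℝ, HasDerivAt (fun r : ℝ => r • (ω : Euc N)) (ω : Euc N) r := fun r => by
    simpa using (hasDerivAt_id r).smul_const (ω : Euc N)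
  set q : ℝ → ℝ := fun r => p₁ r * ξ (r • (ω : Euc N)) +
    p r * fderiv ℝ ξ (r • (ω : Euc N)) (ω : Euc N) with hq
  have hqd : ∀ r, 0 < r → HasDerivAt (fun r => p r * ξ (r • (ω : Euc N))) (q r) r := fun r hr =>
    (hp r hr).fun_mul ((h.2.1 _).hasFDerivAt.comp_hasDerivAt r (hline r))
  have hqc : ContinuousOn q (Set.Ioi 0) := by
    have h1 : Continuous fun r : ℝ => ξ (r • (ω : Euc N)) := by fun_prop
    have h2 : Continuous fun r : ℝ => fderiv ℝ ξ (r • (ω : Euc N)) (ω : Euc N) := by fun_prop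
    exact (hp₁.mul h1.continuousOn).add (hpc.mul h2.continuousOn)
  set S : ℝ := max ε R with hS
  have hεS : ε ≤ S := le_max_left _ _
  have h1 : ∀ r ∈ Set.Ioi (0 : ℝ), r ^ (Module.finrank ℝ (Euc N) - 1) *
      {x : Euc N | ε < ‖x‖}.indicator H (r • (ω : Euc N)) = (Set.Ioc ε S).indicator q r := by
    intro r hr
    have hr0 : 0 < r := hr
    rw [finrank_euclideanSpace_fin]
    by_cases hr1 : ε < r
    · have hmem : r • (ω : Euc N) ∈ {x : Euc N | ε < ‖x‖} := by
        change ε < ‖r • (ω : Euc N)‖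
        rwa [hnorm r hr0]
      rw [Set.indicator_of_mem hmem]
      have hval : r ^ (N - 1) * H (r • (ω : Euc N)) = q r := by
        simp only [hH, hq, hnorm r hr0, map_smul, smul_eq_mul]
        field_simp
        ring
      rw [hval]
      by_cases hr2 : r ≤ S
      · rw [Set.indicator_of_mem (s := Set.Ioc ε S) ⟨hr1, hr2⟩]
      · rw [Set.indicator_of_notMem (s := Set.Ioc ε S) fun h => hr2 h.2]
        have := hR (r • (ω : Euc N)) (by
          rw [hnorm r hr0]; exact (le_max_right _ _).trans (not_le.1 hr2).le)
        simp [hq, this.1, this.2.1]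
    · rw [Set.indicator_of_notMem (s := Set.Ioc ε S) fun h => hr1 h.1,
        Set.indicator_of_notMem (fun hmem => hr1 ?_), mul_zero]
      have : ε < ‖r • (ω : Euc N)‖ := hmem
      rwa [hnorm r hr0] at this
  rw [setIntegral_congr_fun measurableSet_Ioi h1, setIntegral_indicator measurableSet_Ioc,
    Set.inter_eq_self_of_subset_right
      (show Set.Ioc ε S ⊆ Set.Ioi 0 from fun r hr => hε.trans hr.1),
    ← intervalIntegral.integral_of_le hεS,
    intervalIntegral.integral_eq_sub_of_hasDerivAt (f := fun r => p r * ξ (r • (ω : Euc N)))]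
  · have := hR (S • (ω : Euc N)) (by rw [hnorm S (hε.trans_le hεS)]; exact le_max_right _ _)
    simp [this.1]
  · intro r hr
    rw [Set.uIcc_of_le hεS] at hr
    exact hqd r (hε.trans_le hr.1)
  · refine (hqc.mono fun r hr => ?_).intervalIntegrable
    rw [Set.uIcc_of_le hεS] at hr
    exact hε.trans_le hr.1

/-- Exterior Green identity for a radial function `G` against the operator
`-Δ - D |x|⁻² x·∇ - Ψ(|x|)`. -/
theorem integral_exterior_radial_adjoint {N : ℕ} (hN : N ≠ 0) {ξ : Euc N → ℝ} (h : IsC11c ξ)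
    {G G₁ Ψ : ℝ → ℝ} {D : ℝ} (hG : ∀ r, 0 < r → HasDerivAt G (G₁ r) r)
    (hG₁ : ContinuousOn G₁ (Set.Ioi 0)) (hΨ : ContinuousOn Ψ (Set.Ioi 0))
    (hp : ∀ r, 0 < r → HasDerivAt (fun r => r ^ (N - 1) * (G₁ r - D * G r / r))
      (-(r ^ (N - 1) * (Ψ r * G r))) r) {ε : ℝ} (hε : 0 < ε) :
    ∫ x in {x : Euc N | ε < ‖x‖},
      G ‖x‖ * (-lap ξ x - D / ‖x‖ ^ 2 * fderiv ℝ ξ x x - Ψ ‖x‖ * ξ x) =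
      G ε * (∫ x in closedBall (0 : Euc N) ε, lap ξ x) -
        ε ^ (N - 1) * (G₁ ε - D * G ε / ε) *
          ∫ ω : sphere (0 : Euc N) 1, ξ (ε • (ω : Euc N)) ∂(volume : Measure (Euc N)).toSphere := by
  have hmeas : MeasurableSet {x : Euc N | ε < ‖x‖} := measurableSet_lt measurable_const
    measurable_norm
  have hcompl : {x : Euc N | ε < ‖x‖}ᶜ = closedBall (0 : Euc N) ε := by
    ext x; simp
  have hmax : Continuous fun x : Euc N => max ε ‖x‖ := by fun_prop
  have hmaxpos : ∀ x : Euc N, 0 < max ε ‖x‖ := fun x => hε.trans_le (le_max_left _ _)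
  have hGc : ContinuousOn G (Set.Ioi 0) := fun r hr => (hG r hr).continuousAt.continuousWithinAt
  have hfc := h.continuous_fderiv
  have hitg1 : Integrable fun x => G (max ε ‖x‖) * lap ξ x :=
    h.integrable_mul_lap (hGc.comp_continuous hmax hmaxpos)
  have hitg2 : IntegrableOn (fun x => G₁ ‖x‖ / ‖x‖ * fderiv ℝ ξ x x) {x : Euc N | ε < ‖x‖} := by
    have hc : Continuous fun x : Euc N => G₁ (max ε ‖x‖) / max ε ‖x‖ * fderiv ℝ ξ x x :=
      ((hG₁.comp_continuous hmax hmaxpos).div hmax fun x => (hmaxpos x).ne').mul (by fun_prop)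
    obtain ⟨R, -, hR⟩ := h.exists_support_subset
    have hs : HasCompactSupport fun x : Euc N =>
        G₁ (max ε ‖x‖) / max ε ‖x‖ * fderiv ℝ ξ x x := by
      refine HasCompactSupport.intro (isCompact_closedBall (0 : Euc N) R) fun x hx => ?_
      rw [mem_closedBall, dist_zero_right, not_le] at hx
      simp [(hR x hx.le).2.1]
    refine (hc.integrable_of_hasCompactSupport hs).integrableOn.congr_fun (fun x hx => ?_) hmeas
    have hx' : ε < ‖x‖ := hx
    simp only [max_eq_right hx'.le]
  have hEq1 : Set.EqOn (fun x : Euc N => G (max ε ‖x‖) * lap ξ x) (fun x => G ‖x‖ * lap ξ x)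
      {x : Euc N | ε < ‖x‖} := fun x hx => by
    have hx' : ε < ‖x‖ := hx
    simp only [max_eq_right hx'.le]
  have hitg1' := hitg1.integrableOn.congr_fun hEq1 hmeas
  have hitg3 : IntegrableOn (fun x => G ‖x‖ * lap ξ x + G₁ ‖x‖ / ‖x‖ * fderiv ℝ ξ x x)
      {x : Euc N | ε < ‖x‖} := hitg1'.add hitg2
  have hflux := integral_exterior_radial_flux hN h hp
    (((continuousOn_id.pow _).mul (hΨ.mul hGc)).neg) hε
  have hsplit : ∫ x, G (max ε ‖x‖) * lap ξ x = (∫ x in {x : Euc N | ε < ‖x‖}, G ‖x‖ * lap ξ x) +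
      G ε * ∫ x in closedBall (0 : Euc N) ε, lap ξ x := by
    rw [← integral_add_compl hmeas hitg1, setIntegral_congr_fun hmeas hEq1, hcompl,
      ← integral_const_mul]
    congr 1
    refine setIntegral_congr_fun measurableSet_closedBall fun x hx => ?_
    simp only [max_eq_left (mem_closedBall_zero_iff.1 hx)]
  have hA := integral_truncated_radial_mul_lap hN h hG hG₁ hε
  have hpt : Set.EqOn
      (fun x => G ‖x‖ * (-lap ξ x - D / ‖x‖ ^ 2 * fderiv ℝ ξ x x - Ψ ‖x‖ * ξ x))
      (fun x => (‖x‖ ^ (N - 1) * (G₁ ‖x‖ - D * G ‖x‖ / ‖x‖) * fderiv ℝ ξ x x / ‖x‖ +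
          -(‖x‖ ^ (N - 1) * (Ψ ‖x‖ * G ‖x‖)) * ξ x) / ‖x‖ ^ (N - 1) -
        (G ‖x‖ * lap ξ x + G₁ ‖x‖ / ‖x‖ * fderiv ℝ ξ x x)) {x : Euc N | ε < ‖x‖} := by
    intro x hx
    have hx' : ‖x‖ ≠ 0 := (hε.trans hx).ne'
    simp only
    field_simp
    ring
  rw [setIntegral_congr_fun hmeas hpt, integral_sub hflux.1 hitg3,
    integral_add hitg1' hitg2, hflux.2]
  linarith

/-- A radial function `G` with flux `-P` at the origin is a fundamental solution, in the sense of
distributions, of the adjoint of `-Δ - D |x|⁻² x·∇ - Ψ(|x|)`. -/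
theorem integral_radial_adjoint {N : ℕ} (hN : 2 ≤ N) {ξ : Euc N → ℝ} (h : IsC11c ξ)
    {G G₁ Ψ : ℝ → ℝ} {D K P : ℝ} (hG : ∀ r, 0 < r → HasDerivAt G (G₁ r) r)
    (hG₁ : ContinuousOn G₁ (Set.Ioi 0)) (hΨ : ContinuousOn Ψ (Set.Ioi 0))
    (hp : ∀ r, 0 < r → HasDerivAt (fun r => r ^ (N - 1) * (G₁ r - D * G r / r))
      (-(r ^ (N - 1) * (Ψ r * G r))) r)
    (hGb : ∀ R, ∃ M, ∀ r, 0 < r → r ≤ R → |G r| * r ^ (N - 2) ≤ M)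
    (hΨb : ∀ r, 0 < r → |Ψ r| ≤ K)
    (hlim : Tendsto (fun r => r ^ (N - 1) * (G₁ r - D * G r / r)) (𝓝[>] 0) (𝓝 (-P))) :
    ∫ x : Euc N, G ‖x‖ * (-lap ξ x - D / ‖x‖ ^ 2 * fderiv ℝ ξ x x - Ψ ‖x‖ * ξ x) =
      P * sphereArea N * ξ 0 := by
  have hN0 : N ≠ 0 := by lia
  have : Nonempty (Fin N) := Fin.pos_iff_nonempty.1 (Nat.pos_of_ne_zero hN0)
  obtain ⟨R, hR0, hR⟩ := h.exists_support_subset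
  obtain ⟨L, hL0, hL⟩ := h.exists_norm_lap_le
  obtain ⟨A, hA⟩ := (h.1.fderiv ℝ).exists_bound_of_continuous h.continuous_fderiv
  obtain ⟨B, hB⟩ := h.1.exists_bound_of_continuous h.2.1.continuous
  obtain ⟨M, hM⟩ := hGb (max R 1)
  have hA0 : 0 ≤ A := (norm_nonneg _).trans (hA 0)
  have hB0 : 0 ≤ B := (norm_nonneg _).trans (hB 0)
  have hK0 : 0 ≤ K := (abs_nonneg _).trans (hΨb 1 one_pos)
  have hae : ∀ᵐ x : Euc N, x ≠ 0 := measure_eq_zero_iff_ae_notMem.1 (measure_singleton (0 : Euc N))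
  have hGc : ContinuousOn G (Set.Ioi 0) := fun r hr => (hG r hr).continuousAt.continuousWithinAt
  have hradial : ∀ {g : ℝ → ℝ}, ContinuousOn g (Set.Ioi 0) →
      AEStronglyMeasurable (fun x : Euc N => g ‖x‖) := fun {g} hg => by
    rw [← restrict_compl_singleton (μ := (volume : Measure (Euc N))) 0]
    exact (hg.comp continuous_norm.continuousOn fun x hx =>
      norm_pos_iff.2 hx).aestronglyMeasurable (measurableSet_singleton _).compl
  set J : Euc N → ℝ := fun x =>
    G ‖x‖ * (-lap ξ x - D / ‖x‖ ^ 2 * fderiv ℝ ξ x x - Ψ ‖x‖ * ξ x) with hJ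
  have hfc := h.continuous_fderiv
  have hξc := h.2.1.continuous
  have hJm : AEStronglyMeasurable J := by
    have h1 : AEStronglyMeasurable fun x : Euc N => D / ‖x‖ ^ 2 :=
      hradial (g := fun r => D / r ^ 2) (continuousOn_const.div (continuousOn_id.pow 2)
        fun r hr => pow_ne_zero _ (ne_of_gt hr))
    have h2 : Continuous fun x => fderiv ℝ ξ x x := by fun_prop
    exact (hradial hGc).mul (((IsC11c.measurable_lap.aestronglyMeasurable.neg).sub
      (h1.mul h2.aestronglyMeasurable)).sub ((hradial hΨ).mul hξc.aestronglyMeasurable))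
  set C : ℝ := M * (L * R + |D| * A + K * B * R) with hC
  have hdom : Integrable ((ball (0 : Euc N) R).indicator fun x => C / ‖x‖ ^ (N - 1)) := by
    rw [integrable_indicator_iff measurableSet_ball,
      integrableOn_fun_norm_addHaar volume (f := fun r => C / r ^ (N - 1))]
    have : IntegrableOn (fun _ : ℝ => C) (Set.Ioo 0 R) := by
      exact integrableOn_const (by simp)
    refine this.congr_fun (fun r hr => ?_) measurableSet_Ioo
    have := hr.1.ne'
    simp only [finrank_euclideanSpace_fin, smul_eq_mul]
    field_simp
  have hJint : Integrable J := by
    refine hdom.mono' hJm ?_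
    filter_upwards [hae] with x hx
    have hr : 0 < ‖x‖ := norm_pos_iff.2 hx
    rcases le_or_gt R ‖x‖ with hxR | hxR
    · rw [Set.indicator_of_notMem (by simpa using hxR)]
      simp [hJ, hR x hxR]
    rw [Set.indicator_of_mem (by simpa using hxR)]
    have hM' := hM ‖x‖ hr (hxR.le.trans (le_max_left _ _))
    have h1 : |D / ‖x‖ ^ 2 * fderiv ℝ ξ x x| ≤ |D| * A / ‖x‖ := by
      have : |fderiv ℝ ξ x x| ≤ A * ‖x‖ :=
        ((fderiv ℝ ξ x).le_opNorm x).trans (mul_le_mul_of_nonneg_right (hA x) hr.le)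
      rw [abs_mul, abs_div, abs_of_pos (pow_pos hr 2)]
      calc |D| / ‖x‖ ^ 2 * |fderiv ℝ ξ x x| ≤ |D| / ‖x‖ ^ 2 * (A * ‖x‖) := by gcongr
        _ = |D| * A / ‖x‖ := by field_simp
    have h2 : |Ψ ‖x‖ * ξ x| ≤ K * B := by
      rw [abs_mul]; exact mul_le_mul (hΨb _ hr) (hB x) (abs_nonneg _) hK0
    have h3 : |-lap ξ x - D / ‖x‖ ^ 2 * fderiv ℝ ξ x x - Ψ ‖x‖ * ξ x| ≤
        (L * R + |D| * A + K * B * R) / ‖x‖ := by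
      have h4 : |-lap ξ x| ≤ L := by rw [abs_neg]; exact hL x
      calc _ ≤ |-lap ξ x| + |D / ‖x‖ ^ 2 * fderiv ℝ ξ x x| + |Ψ ‖x‖ * ξ x| :=
            (abs_sub _ _).trans (add_le_add_left (abs_sub _ _) _)
        _ ≤ L + |D| * A / ‖x‖ + K * B := by gcongr
        _ = (L * ‖x‖ + |D| * A + K * B * ‖x‖) / ‖x‖ := by field_simp
        _ ≤ _ := by gcongr
    have hsucc : ‖x‖ ^ (N - 1) = ‖x‖ ^ (N - 2) * ‖x‖ := by
      rw [← pow_succ]; congr 1; lia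
    rw [Real.norm_eq_abs, hJ, abs_mul, hC, hsucc]
    calc |G ‖x‖| * _ ≤ M / ‖x‖ ^ (N - 2) * ((L * R + |D| * A + K * B * R) / ‖x‖) := by
          refine mul_le_mul ((le_div_iff₀ (by positivity)).2 hM') h3 (abs_nonneg _) ?_
          exact div_nonneg ((by positivity : (0 : ℝ) ≤ _).trans hM') (by positivity)
      _ = _ := by field_simp
  have hcover : AECover (volume : Measure (Euc N)) (𝓝[>] (0 : ℝ))
      fun ε => {x : Euc N | ε < ‖x‖} := by
    refine ⟨?_, fun ε => measurableSet_lt measurable_const measurable_norm⟩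
    filter_upwards [hae] with x hx
    exact nhdsWithin_le_nhds (gt_mem_nhds (norm_pos_iff.2 hx))
  have hlim1 := hcover.integral_tendsto_of_countably_generated hJint
  have hlim2 : Tendsto (fun ε => G ε * ∫ x in closedBall (0 : Euc N) ε, lap ξ x)
      (𝓝[>] (0 : ℝ)) (𝓝 0) := by
    set v := (volume : Measure (Euc N)).real (ball 0 1) with hv
    have hsq : Tendsto (fun ε : ℝ => M * L * v * ε ^ 2) (𝓝[>] (0 : ℝ)) (𝓝 0) := by
      have : Continuous fun ε : ℝ => M * L * v * ε ^ 2 := by fun_prop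
      simpa using (this.tendsto 0).mono_left nhdsWithin_le_nhds
    refine squeeze_zero_norm' ?_ hsq
    have h1 : ∀ᶠ ε : ℝ in 𝓝[>] 0, ε < 1 := nhdsWithin_le_nhds (gt_mem_nhds one_pos)
    filter_upwards [self_mem_nhdsWithin, h1] with ε hε hε1
    have hε0 : 0 < ε := hε
    have hM' := hM ε hε0 (hε1.le.trans (le_max_right _ _))
    have h2 := norm_setIntegral_le_of_norm_le_const (μ := (volume : Measure (Euc N)))
      (s := closedBall 0 ε) measure_closedBall_lt_top (fun x _ => hL x)
    rw [Measure.addHaar_real_closedBall _ _ hε0.le, finrank_euclideanSpace_fin] at h2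
    have hpow : ε ^ N = ε ^ (N - 2) * ε ^ 2 := by rw [← pow_add]; congr 1; lia
    rw [norm_mul, Real.norm_eq_abs]
    calc _ ≤ |G ε| * (L * (ε ^ N * v)) := by gcongr
      _ = |G ε| * ε ^ (N - 2) * (L * v * ε ^ 2) := by rw [hpow]; ring
      _ ≤ M * (L * v * ε ^ 2) := by gcongr
      _ = _ := by ring
  have hlim3 : Tendsto (fun ε : ℝ => ∫ ω : sphere (0 : Euc N) 1, ξ (ε • (ω : Euc N))
      ∂(volume : Measure (Euc N)).toSphere) (𝓝[>] (0 : ℝ)) (𝓝 (sphereArea N * ξ 0)) := by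
    have hc := continuous_parametric_integral_of_continuous
      (μ := (volume : Measure (Euc N)).toSphere)
      (f := fun (ε : ℝ) (ω : sphere (0 : Euc N) 1) => ξ (ε • (ω : Euc N))) (by fun_prop)
      isCompact_univ
    simp only [Measure.restrict_univ] at hc
    have h0 := (hc.tendsto 0).mono_left (nhdsWithin_le_nhds (s := Set.Ioi 0))
    simp only [zero_smul, integral_const, Measure.toSphere_real_apply_univ,
      finrank_euclideanSpace_fin, smul_eq_mul] at h0
    exact h0
  have hlim4 := (hlim2.sub (hlim.mul hlim3)).congr' (f₂ := fun ε => ∫ x in {x | ε < ‖x‖}, J x) (by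
    filter_upwards [self_mem_nhdsWithin] with ε hε
    exact (integral_exterior_radial_adjoint hN0 h hG hG₁ hΨ hp hε).symm)
  rw [tendsto_nhds_unique hlim1 hlim4]
  ring

theorem hasDerivAt_comp_log_div_pow {m : ℝ → ℝ} {m' r : ℝ} (hr : 0 < r)
    (hm : HasDerivAt m m' (Real.log r)) (d : ℕ) :
    HasDerivAt (fun r => m (Real.log r) / r ^ d) ((m' - d * m (Real.log r)) / r ^ (d + 1)) r := by
  have h1 : HasDerivAt (fun r => m (Real.log r)) (m' * r⁻¹) r :=
    hm.comp r (Real.hasDerivAt_log hr.ne')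
  refine (h1.fun_div (hasDerivAt_pow d r) (pow_ne_zero _ hr.ne')).congr_deriv ?_
  rcases d with _ | d
  · simp; rfl
  · simp only [Nat.add_sub_cancel]
    field_simp
    ring

/-- The distributional identity for a solution `|x| ^ τ₋ m(log |x|)` written in terms of the
solution `m` of the Emden-Fowler equation. -/
theorem distribIdentity_of_profile {N : ℕ} (hN : 3 ≤ N) {μ ρ k : ℝ} (hμ0 : μ < mu0 N)
    {m n : ℝ → ℝ} (hm : ∀ t, HasDerivAt m (n t) t)
    (hn : ∀ t, HasDerivAt n (2 * √(mu0 N - μ) * n t -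
      μ * (ρ - 1) * Real.exp (2 * t) / (1 + Real.exp (2 * t)) * m t) t)
    (hb : ∃ C, ∀ t ≤ 0, |m t| ≤ C)
    (hk : Tendsto (fun t => 2 * √(mu0 N - μ) * m t - n t) atBot (𝓝 (2 * √(mu0 N - μ) * k))) :
    DistribIdentity N μ (Vrho N ρ)
      (fun x => Real.exp (tauMinus N μ * Real.log ‖x‖) * m (Real.log ‖x‖)) k := by
  intro ξ hξ
  set a := √(mu0 N - μ) with ha
  obtain ⟨C, hC⟩ := hb
  obtain ⟨d, rfl⟩ := Nat.exists_eq_add_of_le' hN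
  have hmc : Continuous m := continuous_iff_continuousAt.2 fun t => (hm t).continuousAt
  have hnc : Continuous n := continuous_iff_continuousAt.2 fun t => (hn t).continuousAt
  have hlogc : ContinuousOn Real.log (Set.Ioi 0) := fun r hr =>
    (Real.continuousAt_log (ne_of_gt hr)).continuousWithinAt
  have hplus : 2 * tauPlus (d + 3) μ = 2 * a - (d + 1) := by
    rw [tauPlus]; push_cast; ring
  have hflux : ∀ r : ℝ, 0 < r → r ^ (d + 2) * ((n (Real.log r) - ↑(d + 1) * m (Real.log r)) /
      r ^ (d + 1 + 1) - 2 * tauPlus (d + 3) μ * (m (Real.log r) / r ^ (d + 1)) / r) =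
      n (Real.log r) - 2 * a * m (Real.log r) := fun r hr => by
    rw [hplus]; push_cast; field_simp; ring
  have key := integral_radial_adjoint (N := d + 3) (by lia) hξ
    (G := fun r => m (Real.log r) / r ^ (d + 1))
    (G₁ := fun r => (n (Real.log r) - ↑(d + 1) * m (Real.log r)) / r ^ (d + 1 + 1))
    (Ψ := fun r => μ * (ρ - 1) / (1 + r ^ 2)) (D := 2 * tauPlus (d + 3) μ)
    (K := |μ * (ρ - 1)|) (P := 2 * a * k) ?_ ?_ ?_ ?_ ?_ ?_ ?_
  · rw [cMu, if_pos hμ0, ← ha, show 2 * a * sphereArea (d + 3) * k * ξ 0 =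
      2 * a * k * sphereArea (d + 3) * ξ 0 by ring, ← key]
    refine integral_congr_ae ?_
    have hae : ∀ᵐ x : Euc (d + 3), x ≠ 0 :=
      measure_eq_zero_iff_ae_notMem.1 (measure_singleton (0 : Euc (d + 3)))
    filter_upwards [hae] with x hx
    have hr : 0 < ‖x‖ := norm_pos_iff.2 hx
    have hpow : Real.exp (tauMinus (d + 3) μ * Real.log ‖x‖) * ‖x‖ ^ tauPlus (d + 3) μ =
        1 / ‖x‖ ^ (d + 1) := by
      rw [Real.rpow_def_of_pos hr, ← Real.exp_add, eq_div_iff (by positivity),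
        ← Real.exp_log (pow_pos hr (d + 1)), ← Real.exp_add, Real.exp_eq_one_iff, Real.log_pow,
        tauMinus, tauPlus]
      push_cast; ring
    have hV : μ * (Vrho (d + 3) ρ x - ‖x‖ ^ (-2 : ℝ)) = μ * (ρ - 1) / (1 + ‖x‖ ^ 2) := by
      rw [Vrho, Real.rpow_neg hr.le, Real.rpow_ofNat]
      field_simp
      ring
    rw [LstarMuV, LstarMu, hV]
    linear_combination m (Real.log ‖x‖) * (-lap ξ x - 2 * tauPlus (d + 3) μ / ‖x‖ ^ 2 *
      fderiv ℝ ξ x x - μ * (ρ - 1) / (1 + ‖x‖ ^ 2) * ξ x) * hpow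
  · exact fun r hr => hasDerivAt_comp_log_div_pow hr (hm _) _
  · exact ((hnc.comp_continuousOn hlogc).sub (continuousOn_const.mul
      (hmc.comp_continuousOn hlogc))).div (continuousOn_id.pow _)
      fun r hr => pow_ne_zero _ (ne_of_gt hr)
  · exact Continuous.continuousOn (continuous_const.div (by fun_prop) fun r => by positivity)
  · intro r hr
    have hlog := Real.hasDerivAt_log hr.ne'
    have h1 : HasDerivAt (fun r => n (Real.log r) - 2 * a * m (Real.log r)) _ r :=
      ((hn (Real.log r)).comp r hlog).fun_sub
        (((hm (Real.log r)).comp r hlog).const_mul (2 * a))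
    refine (h1.congr_of_eventuallyEq ?_).congr_deriv ?_
    · filter_upwards [lt_mem_nhds hr] with s hs using hflux s hs
    · rw [exp_two_mul_log hr]
      change _ = -(r ^ (d + 2) * _)
      field_simp
      ring
  · intro R
    obtain ⟨C', hC'⟩ := (isCompact_Icc (a := 0) (b := Real.log R)).exists_bound_of_continuousOn
      hmc.continuousOn
    refine ⟨max C C', fun r hr hrR => ?_⟩
    change |m (Real.log r) / r ^ (d + 1)| * r ^ (d + 1) ≤ _
    rw [abs_div, abs_of_pos (pow_pos hr _), div_mul_cancel₀ _ (pow_pos hr _).ne']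
    rcases le_total (Real.log r) 0 with h | h
    · exact (hC _ h).trans (le_max_left _ _)
    · exact (hC' _ ⟨h, Real.log_le_log hr hrR⟩).trans (le_max_right _ _)
  · intro r hr
    rw [abs_div, abs_of_pos (by positivity : 0 < 1 + r ^ 2)]
    exact div_le_self (abs_nonneg _) (by nlinarith [sq_nonneg r])
  · refine ((hk.comp Real.tendsto_log_nhdsGT_zero).neg).congr' ?_
    filter_upwards [self_mem_nhdsWithin] with r hr
    refine Eq.trans ?_ (hflux r hr).symm
    simp only [Function.comp_apply]
    ring

/-- The function `|x| ^ τ₋ m(log |x|)` solves the equation if `m` solves the Emden-Fowler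
equation. -/
theorem isSolution_of_profile {N : ℕ} {μ ρ : ℝ} (hμ0 : μ < mu0 N)
    {m n : ℝ → ℝ} (hm : ∀ t, HasDerivAt m (n t) t)
    (hn : ∀ t, HasDerivAt n (2 * √(mu0 N - μ) * n t -
      μ * (ρ - 1) * Real.exp (2 * t) / (1 + Real.exp (2 * t)) * m t) t) :
    IsSolution N μ (Vrho N ρ)
      (fun x => Real.exp (tauMinus N μ * Real.log ‖x‖) * m (Real.log ‖x‖)) := by
  set a := √(mu0 N - μ) with ha
  set τ := tauMinus N μ with hτ
  have hτa : τ = -((N : ℝ) - 2) / 2 - a := rfl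
  have ha2 : a ^ 2 = ((N : ℝ) - 2) ^ 2 / 4 - μ := Real.sq_sqrt (sub_nonneg.2 hμ0.le)
  have hmc : Continuous m := continuous_iff_continuousAt.2 fun t => (hm t).continuousAt
  have hnc : Continuous n := continuous_iff_continuousAt.2 fun t => (hn t).continuousAt
  have hexp : ∀ t, HasDerivAt (fun t => Real.exp (τ * t)) (τ * Real.exp (τ * t)) t := fun t => by
    simpa [mul_comm] using ((hasDerivAt_id t).const_mul τ).exp
  have hF : ∀ t, HasDerivAt (fun t => Real.exp (τ * t) * m t)
      (Real.exp (τ * t) * (τ * m t + n t)) t := fun t =>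
    ((hexp t).fun_mul (hm t)).congr_deriv (by ring)
  have hF₁ : ∀ t, HasDerivAt (fun t => Real.exp (τ * t) * (τ * m t + n t))
      (Real.exp (τ * t) * (τ ^ 2 * m t + 2 * τ * n t + (2 * a * n t -
        μ * (ρ - 1) * Real.exp (2 * t) / (1 + Real.exp (2 * t)) * m t))) t := fun t =>
    ((hexp t).fun_mul (((hm t).const_mul τ).fun_add (hn t))).congr_deriv (by ring)
  have hF₂ : Continuous fun t => Real.exp (τ * t) * (τ ^ 2 * m t + 2 * τ * n t + (2 * a * n t -
        μ * (ρ - 1) * Real.exp (2 * t) / (1 + Real.exp (2 * t)) * m t)) := by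
    have : Continuous fun t => μ * (ρ - 1) * Real.exp (2 * t) / (1 + Real.exp (2 * t)) :=
      Continuous.div (by fun_prop) (by fun_prop) fun t => by positivity
    fun_prop
  refine ⟨contDiffOn_comp_log_norm (contDiff_two_of_hasDerivAt hF hF₁ hF₂), fun x hx => ?_⟩
  have hr : ‖x‖ ≠ 0 := norm_ne_zero_iff.2 hx
  rw [lap_comp_log_norm hF hF₁ hx, Vrho_eq ρ hx]
  set t := Real.log ‖x‖
  have hE : 1 + Real.exp (2 * t) ≠ 0 := by positivity
  generalize Real.exp (2 * t) = E at hE ⊢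
  have hquad : τ ^ 2 + (N - 2) * τ = -μ := by rw [hτa]; linear_combination ha2
  have hlin : 2 * τ + 2 * a + (N - 2) = 0 := by rw [hτa]; ring
  field_simp
  linear_combination (-Real.exp (τ * t) * (1 + E) * m t) * hquad -
    (Real.exp (τ * t) * (1 + E) * n t) * hlin

/-- Corollary 1.4 (dichotomy for the potentials V_ρ). -/
theorem Vrho_dichotomy
    (N : ℕ) (hN : 3 ≤ N) (μ : ℝ) (hμ : 0 < μ) (hμ0 : μ < mu0 N) :
    ∃ ρstar : ℝ, mu0 N / μ ≤ ρstar ∧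
      (∀ ρ : ℝ, 1 ≤ ρ → ρ < ρstar →
        ∃ (u : Euc N → ℝ) (k : ℝ), 0 < k ∧ (∀ x : Euc N, x ≠ 0 → 0 < u x) ∧
          IsSolution N μ (Vrho N ρ) u ∧ DistribIdentity N μ (Vrho N ρ) u k) ∧
      (∀ ρ : ℝ, ρstar < ρ →
        ¬ ∃ (u : Euc N → ℝ) (k : ℝ), 0 < k ∧ (∀ x : Euc N, x ≠ 0 → 0 < u x) ∧
          IsSolution N μ (Vrho N ρ) u ∧ DistribIdentity N μ (Vrho N ρ) u k) := by
  have hμ2 : 0 < mu0 N - μ := sub_pos.2 hμ0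
  have ha : 0 < √(mu0 N - μ) := Real.sqrt_pos.2 hμ2
  refine ⟨mu0 N / μ, le_rfl, fun ρ hρ1 hρ => ?_, fun ρ hρ => ?_⟩
  · have hρμ : ρ * μ < mu0 N := (lt_div_iff₀ hμ).1 hρ
    obtain ⟨m, n, hm, hn, hpos, ⟨C, hC⟩, k, hk0, hk⟩ := exists_profile ha
      (mul_nonneg hμ.le (sub_nonneg.2 hρ1)) (by rw [Real.sq_sqrt hμ2.le]; linarith)
    exact ⟨_, k, hk0, fun x _ => mul_pos (Real.exp_pos _) (hpos _),
      isSolution_of_profile hμ0 hm hn, distribIdentity_of_profile hN hμ0 hm hn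
        ⟨C, fun t ht => (abs_of_pos (hpos t)).trans_le (hC t ht)⟩ hk⟩
  · rintro ⟨u, -, -, hpos, hu, -⟩
    exact not_exists_pos_solution hN hμ hρ hpos hu
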